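/- arXiv:2308.00314 — 4 statements merged into one kernel-verified Lean document; each statement's English description precedes it below -/
import Mathlib

section
/- For every κ₀ > 0, R ≥ 1, T > 0 and M > 0 there exists a constant C > 0 (depending only on κ₀, R, T, 1/T and M) with the following property. Let f : (0,∞) → ℝ be C² with f' > 0 on (0,∞), and let (u,m) be a classical R-periodic solution of the 1D MFG system with coupling f on ℝ × [0,T]. Assume that s·f'(s) ≤ κ₀ and s·|f''(s)|/f'(s) ≤ κ₀ for every s ∈ (0, 2·max( sup_x m(x,0), sup_x m(x,T) )], and that sup_x |f(m(x,0))| + sup_x |∂_x( f(m(·,0)) )(x)| ≤ M and sup_x |f(m(x,T))| + sup_x |∂_x( f(m(·,T)) )(x)| ≤ M. Then, writing v = f∘m, the energy estimate ∫_0^T ∫_0^R ( (∂_x v)² + (∂_t v)² ) dx dt ≤ C holds. -/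
open Set

/-- Partial derivative in the first (space) variable. -/
noncomputable def pdx (u : ℝ → ℝ → ℝ) (x t : ℝ) : ℝ := deriv (fun y => u y t) x

/-- Partial derivative in the second (time) variable. -/
noncomputable def pdt (u : ℝ → ℝ → ℝ) (x t : ℝ) : ℝ := deriv (fun s => u x s) t

/-- The closed space-time strip `ℝ × [0,T]`. -/
def strip (T : ℝ) : Set (ℝ × ℝ) := {p : ℝ × ℝ | p.2 ∈ Icc 0 T}

/-- Smoothness on the closed strip. -/
def SmoothStrip (T : ℝ) (φ : ℝ × ℝ → ℝ) : Prop := ContDiffOn ℝ (⊤ : ℕ∞) φ (strip T)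

/-- Space derivative, up to the boundary of the strip. -/
noncomputable def DX (T : ℝ) (φ : ℝ × ℝ → ℝ) (q : ℝ × ℝ) : ℝ :=
  fderivWithin ℝ φ (strip T) q (1, 0)

/-- Time derivative, one-sided on the boundary of the strip. -/
noncomputable def DT (T : ℝ) (φ : ℝ × ℝ → ℝ) (q : ℝ × ℝ) : ℝ :=
  fderivWithin ℝ φ (strip T) q (0, 1)

lemma mem_strip {T x t : ℝ} : (x, t) ∈ strip T ↔ t ∈ Icc 0 T := Iff.rfl

lemma strip_eq_prod (T : ℝ) : strip T = univ ×ˢ Icc 0 T := by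
  ext q; simp [strip]

lemma uniqueDiffOn_strip {T : ℝ} (hT : 0 < T) : UniqueDiffOn ℝ (strip T) := by
  rw [strip_eq_prod]
  exact uniqueDiffOn_univ.prod (uniqueDiffOn_Icc hT)

lemma strip_mem_nhds {T x t : ℝ} (ht : t ∈ Ioo 0 T) : strip T ∈ nhds (x, t) := by
  rw [strip_eq_prod]
  exact prod_mem_nhds Filter.univ_mem (Icc_mem_nhds ht.1 ht.2)

lemma mem_closure_interior_strip {T x t : ℝ} (hT : 0 < T) (ht : t ∈ Icc 0 T) :
    (x, t) ∈ closure (interior (strip T)) := by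
  rw [strip_eq_prod, interior_prod_eq, closure_prod_eq, interior_univ, closure_univ, interior_Icc,
    closure_Ioo hT.ne]
  exact ⟨mem_univ _, ht⟩

namespace SmoothStrip

variable {T : ℝ} {φ : ℝ × ℝ → ℝ}

lemma fderivWithin_apply (hT : 0 < T) (hφ : SmoothStrip T φ) (w : ℝ × ℝ) :
    SmoothStrip T (fun q => fderivWithin ℝ φ (strip T) q w) := by
  have h : ContDiffOn ℝ (⊤ : ℕ∞) (fderivWithin ℝ φ (strip T)) (strip T) :=
    ContDiffOn.fderivWithin hφ (uniqueDiffOn_strip hT) (by simp)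
  exact h.clm_apply contDiffOn_const

lemma dx (hT : 0 < T) (hφ : SmoothStrip T φ) : SmoothStrip T (DX T φ) :=
  hφ.fderivWithin_apply hT _

lemma dt (hT : 0 < T) (hφ : SmoothStrip T φ) : SmoothStrip T (DT T φ) :=
  hφ.fderivWithin_apply hT _

lemma hasFDerivWithinAt (hφ : SmoothStrip T φ) {q : ℝ × ℝ} (hq : q ∈ strip T) :
    HasFDerivWithinAt φ (fderivWithin ℝ φ (strip T) q) (strip T) q :=
  ((hφ.differentiableOn (by simp)) q hq).hasFDerivWithinAt

lemma hasDerivAt_space (hφ : SmoothStrip T φ) {t : ℝ} (ht : t ∈ Icc 0 T) (x : ℝ) :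
    HasDerivAt (fun y => φ (y, t)) (DX T φ (x, t)) x := by
  have h := hφ.hasFDerivWithinAt (q := (x, t)) ht
  have hl : HasDerivWithinAt (fun y : ℝ => (y, t)) ((1 : ℝ), (0 : ℝ)) univ x :=
    ((hasDerivAt_id x).prodMk (hasDerivAt_const x t)).hasDerivWithinAt
  have := h.comp_hasDerivWithinAt x hl (fun y _ => ht)
  exact hasDerivWithinAt_univ.1 this

lemma hasDerivWithinAt_time (hφ : SmoothStrip T φ) {t : ℝ} (ht : t ∈ Icc 0 T) (x : ℝ) :
    HasDerivWithinAt (fun s => φ (x, s)) (DT T φ (x, t)) (Icc 0 T) t := by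
  have h := hφ.hasFDerivWithinAt (q := (x, t)) ht
  have hl : HasDerivWithinAt (fun s : ℝ => (x, s)) ((0 : ℝ), (1 : ℝ)) (Icc 0 T) t :=
    ((hasDerivAt_const t x).prodMk (hasDerivAt_id t)).hasDerivWithinAt
  exact h.comp_hasDerivWithinAt t hl (fun s hs => hs)

lemma dx_eq (hφ : SmoothStrip T φ) {t : ℝ} (ht : t ∈ Icc 0 T) {x d : ℝ} {ψ : ℝ → ℝ}
    (he : ∀ y, φ (y, t) = ψ y) (hd : HasDerivAt ψ d x) : DX T φ (x, t) = d := by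
  have h := hφ.hasDerivAt_space ht x
  rw [show (fun y => φ (y, t)) = ψ from funext he] at h
  exact h.unique hd

lemma dt_eq (hT : 0 < T) (hφ : SmoothStrip T φ) {t : ℝ} (ht : t ∈ Icc 0 T) {x d : ℝ} {ψ : ℝ → ℝ}
    (he : ∀ s ∈ Icc 0 T, φ (x, s) = ψ s) (hd : HasDerivWithinAt ψ d (Icc 0 T) t) :
    DT T φ (x, t) = d := by
  have h := hφ.hasDerivWithinAt_time ht x
  exact (uniqueDiffOn_Icc hT t ht).eq_deriv _ h (hd.congr he (he t ht))

lemma dt_dx (hT : 0 < T) (hφ : SmoothStrip T φ) {x t : ℝ} (ht : t ∈ Icc 0 T) :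
    DT T (DX T φ) (x, t) = DX T (DT T φ) (x, t) := by
  have hs := ((hφ (x, t) ht).isSymmSndFDerivWithinAt (n := (⊤ : ℕ∞))
    (by simpa using (WithTop.coe_le_coe.2 (le_top (a := (2 : ℕ∞))))) (uniqueDiffOn_strip hT) (mem_closure_interior_strip hT ht) ht)
  have hd : DifferentiableWithinAt ℝ (fderivWithin ℝ φ (strip T)) (strip T) (x, t) := by
    have h : ContDiffOn ℝ (⊤ : ℕ∞) (fderivWithin ℝ φ (strip T)) (strip T) :=
      ContDiffOn.fderivWithin hφ (uniqueDiffOn_strip hT) (by simp)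
    exact h.differentiableOn (by simp) _ ht
  have key : ∀ w : ℝ × ℝ, fderivWithin ℝ (fun q => fderivWithin ℝ φ (strip T) q w) (strip T) (x, t)
      = (fderivWithin ℝ (fderivWithin ℝ φ (strip T)) (strip T) (x, t)).flip w := by
    intro w
    have := hd.hasFDerivWithinAt.clm_apply (hasFDerivWithinAt_const w (x, t) (strip T))
    have h2 := this.fderivWithin (uniqueDiffOn_strip hT _ ht)
    rw [h2]; ext <;> simp
  have h := hs (1, 0) (0, 1)
  simp only [DX, DT]
  unfold DX DT
  rw [key, key]
  simpa using h.symm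

/-- Derivative along a line through an interior point. -/
lemma hasDerivAt_line (hφ : SmoothStrip T φ) {x t a b s : ℝ} (ht : t + b * s ∈ Ioo 0 T) :
    HasDerivAt (fun r => φ (x + a * r, t + b * r))
      (a * DX T φ (x + a * s, t + b * s) + b * DT T φ (x + a * s, t + b * s)) s := by
  have h := (hφ.hasFDerivWithinAt (q := (x + a * s, t + b * s)) ⟨ht.1.le, ht.2.le⟩).hasFDerivAt
    (strip_mem_nhds ht)
  have hl : HasDerivAt (fun r : ℝ => (x + a * r, t + b * r)) (a, b) s := by
    have h1 : HasDerivAt (fun r : ℝ => x + a * r) a s := by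
      simpa using ((hasDerivAt_id s).const_mul a).const_add x
    have h2 : HasDerivAt (fun r : ℝ => t + b * r) b s := by
      simpa using ((hasDerivAt_id s).const_mul b).const_add t
    exact h1.prodMk h2
  have := h.comp_hasDerivAt s hl
  have e : ((a, b) : ℝ × ℝ) = a • ((1 : ℝ), (0 : ℝ)) + b • ((0 : ℝ), (1 : ℝ)) := by simp
  rw [e, map_add, map_smul, map_smul] at this
  exact this

lemma continuousOn (hφ : SmoothStrip T φ) : ContinuousOn φ (strip T) := ContDiffOn.continuousOn hφ

end SmoothStrip

lemma second_deriv_nonpos_of_isLocalMax {g h : ℝ → ℝ} {c s : ℝ} (hmax : IsLocalMax g s)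
    (hg : ∀ᶠ r in nhds s, HasDerivAt g (h r) r) (hh : HasDerivAt h c s) : c ≤ 0 := by
  by_contra! hc
  have h0 : h s = 0 := hmax.hasDerivAt_eq_zero hg.self_of_nhds
  have hmin : ∀ᶠ r in nhdsWithin s (Ioi s), 0 < h r := by
    have := hh.hasDerivWithinAt (s := Ioi s)
    rw [hasDerivWithinAt_iff_tendsto_slope' (by simp)] at this
    filter_upwards [this.eventually (lt_mem_nhds hc), self_mem_nhdsWithin] with r hr hrs
    rw [slope_def_field, h0, sub_zero] at hr
    exact (div_pos_iff_of_pos_right (sub_pos.2 hrs)).1 hr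
  have hev := (hg.filter_mono (nhdsWithin_le_nhds (s := Ioi s))).and
    (hmin.and (Filter.Eventually.filter_mono nhdsWithin_le_nhds hmax))
  obtain ⟨e, he, hI⟩ := (mem_nhdsGT_iff_exists_Ioo_subset).1 hev
  set r := (s + e) / 2 with hr
  have he' : s < e := he
  have hmem : ∀ y ∈ Ioc s r, y ∈ Ioo s e := fun y hy => ⟨hy.1, by linarith [hy.2]⟩
  have hcont : ContinuousOn g (Icc s r) := by
    intro y hy
    rcases eq_or_lt_of_le hy.1 with h1 | h1
    · rw [← h1]; exact hg.self_of_nhds.continuousAt.continuousWithinAt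
    · exact (hI (hmem y ⟨h1, hy.2⟩)).1.continuousAt.continuousWithinAt
  have hmono : StrictMonoOn g (Icc s r) := by
    apply strictMonoOn_of_deriv_pos (convex_Icc _ _) hcont
    intro y hy
    rw [interior_Icc] at hy
    have := hI (hmem y ⟨hy.1, hy.2.le⟩)
    rw [this.1.deriv]; exact this.2.1
  have h1 := hmono ⟨le_rfl, by linarith⟩ ⟨by linarith, le_rfl⟩ (show s < r by linarith)
  have h2 := (hI (hmem r ⟨by linarith, le_rfl⟩)).2.2
  linarith

/-- First and second order conditions at a maximum point on the closed strip. -/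
lemma SmoothStrip.maximum_conditions {T : ℝ} (hT : 0 < T) {φ : ℝ × ℝ → ℝ} (hφ : SmoothStrip T φ)
    {x t : ℝ} (ht : t ∈ Icc 0 T) (hmax : ∀ q ∈ strip T, φ q ≤ φ (x, t)) :
    DX T φ (x, t) = 0 ∧ (0 < t → 0 ≤ DT T φ (x, t)) ∧ (t < T → DT T φ (x, t) ≤ 0) ∧
      (0 < t → t < T → ∀ a b : ℝ, a ^ 2 * DX T (DX T φ) (x, t) + 2 * a * b * DX T (DT T φ) (x, t)
        + b ^ 2 * DT T (DT T φ) (x, t) ≤ 0) := by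
  have hmt : IsLocalMaxOn (fun s => φ (x, s)) (Icc 0 T) t :=
    Filter.eventually_of_mem self_mem_nhdsWithin fun s hs => hmax (x, s) hs
  have hder := hφ.hasDerivWithinAt_time ht x
  refine ⟨?_, ?_, ?_, ?_⟩
  · have hm : IsLocalMax (fun y => φ (y, t)) x :=
      Filter.Eventually.of_forall fun y => hmax (y, t) ht
    exact hm.hasDerivAt_eq_zero (hφ.hasDerivAt_space ht x)
  · intro h0
    have h := hmt.hasFDerivWithinAt_nonpos hder.hasFDerivWithinAt (y := 0 - t)
      (mem_posTangentConeAt_of_segment_subset (by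
        rw [add_sub_cancel, segment_symm, segment_eq_Icc ht.1]
        exact Icc_subset_Icc_right ht.2))
    simp at h
    nlinarith
  · intro h0
    have h := hmt.hasFDerivWithinAt_nonpos hder.hasFDerivWithinAt (y := T - t)
      (mem_posTangentConeAt_of_segment_subset (by
        rw [add_sub_cancel, segment_eq_Icc ht.2]
        exact Icc_subset_Icc_left ht.1))
    simp at h
    nlinarith
  · intro h0 h1 a b
    have hev : ∀ᶠ s in nhds (0 : ℝ), t + b * s ∈ Ioo 0 T := by
      have hc : ContinuousAt (fun s : ℝ => t + b * s) 0 := by fun_prop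
      exact hc (by simpa using Ioo_mem_nhds h0 h1)
    have hm : IsLocalMax (fun r => φ (x + a * r, t + b * r)) 0 := by
      filter_upwards [hev] with s hs
      simpa using hmax (x + a * s, t + b * s) ⟨hs.1.le, hs.2.le⟩
    have h00 : t + b * 0 ∈ Ioo 0 T := by simpa using ⟨h0, h1⟩
    have := second_deriv_nonpos_of_isLocalMax hm (hev.mono fun s hs => hφ.hasDerivAt_line hs)
      ((((hφ.dx hT).hasDerivAt_line (x := x) (a := a) h00).const_mul a).add
        (((hφ.dt hT).hasDerivAt_line (x := x) (a := a) h00).const_mul b))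
    simp only [mul_zero, add_zero] at this
    rw [hφ.dt_dx hT ht] at this
    linarith

lemma exists_max_of_periodic {T R : ℝ} (hT : 0 < T) (hR : 0 < R) {φ : ℝ × ℝ → ℝ}
    (hφ : ContinuousOn φ (strip T)) (hper : ∀ x t, t ∈ Icc 0 T → φ (x + R, t) = φ (x, t)) :
    ∃ x t, t ∈ Icc 0 T ∧ ∀ q ∈ strip T, φ q ≤ φ (x, t) := by
  have hsub : Icc 0 R ×ˢ Icc 0 T ⊆ strip T := fun q hq => hq.2
  obtain ⟨⟨x, t⟩, hq, hm⟩ := (isCompact_Icc.prod isCompact_Icc).exists_isMaxOn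
    (s := Icc (0 : ℝ) R ×ˢ Icc (0 : ℝ) T) ⟨(0, 0), ⟨le_rfl, hR.le⟩, ⟨le_rfl, hT.le⟩⟩ (hφ.mono hsub)
  refine ⟨x, t, hq.2, ?_⟩
  rintro ⟨y, s⟩ hs
  have hp : Function.Periodic (fun y => φ (y, s)) R := fun y => hper y s hs
  obtain ⟨y', hy', he⟩ := hp.exists_mem_Ico₀ hR y
  have : φ (y, s) = φ (y', s) := he
  rw [this]
  exact hm (a := (y', s)) ⟨⟨hy'.1, hy'.2.le⟩, hs⟩


/-- A space-periodic solution `(u, n)` with `n = log m` and `F s = f (exp s)`; `F1`, `F2` are the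
first two derivatives of `F`. -/
structure LogSolution (R T : ℝ) (F F1 F2 : ℝ → ℝ) (u n : ℝ × ℝ → ℝ) : Prop where
  hT : 0 < T
  hR : 0 < R
  smooth_u : SmoothStrip T u
  smooth_n : SmoothStrip T n
  hF : ∀ s, HasDerivAt F (F1 s) s
  hF1 : ∀ s, HasDerivAt F1 (F2 s) s
  F1_pos : ∀ s, 0 < F1 s
  periodic_u : ∀ x t, t ∈ Icc 0 T → u (x + R, t) = u (x, t)
  periodic_n : ∀ x t, t ∈ Icc 0 T → n (x + R, t) = n (x, t)
  hamilton_jacobi : ∀ x t, t ∈ Icc 0 T →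
    DT T u (x, t) = (DX T u (x, t)) ^ 2 / 2 - F (n (x, t))
  continuity : ∀ x t, t ∈ Icc 0 T →
    DT T n (x, t) = DX T (DX T u) (x, t) + DX T u (x, t) * DX T n (x, t)

namespace SmoothStrip

variable {T R : ℝ} {φ ψ : ℝ × ℝ → ℝ}

lemma congr (hφ : SmoothStrip T φ) (h : ∀ x t, t ∈ Icc 0 T → ψ (x, t) = φ (x, t)) :
    SmoothStrip T ψ :=
  ContDiffOn.congr hφ fun q hq => h q.1 q.2 hq

lemma periodic_dx (hφ : SmoothStrip T φ) (hper : ∀ x t, t ∈ Icc 0 T → φ (x + R, t) = φ (x, t))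
    (x t : ℝ) (ht : t ∈ Icc 0 T) : DX T φ (x + R, t) = DX T φ (x, t) := by
  have h := (hφ.hasDerivAt_space ht (x + R)).comp_add_const x R
  exact (hφ.dx_eq ht (fun y => (hper y t ht).symm) h).symm

lemma periodic_dt (hT : 0 < T) (hφ : SmoothStrip T φ)
    (hper : ∀ x t, t ∈ Icc 0 T → φ (x + R, t) = φ (x, t))
    (x t : ℝ) (ht : t ∈ Icc 0 T) : DT T φ (x + R, t) = DT T φ (x, t) :=
  (hφ.dt_eq hT ht (fun s hs => (hper x s hs).symm) (hφ.hasDerivWithinAt_time ht (x + R))).symm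

end SmoothStrip

namespace LogSolution

variable {R T : ℝ} {F F1 F2 : ℝ → ℝ} {u n : ℝ × ℝ → ℝ}

lemma smooth_F (h : LogSolution R T F F1 F2 u n) : SmoothStrip T (fun q => F (n q)) := by
  have hp := h.smooth_u.dx h.hT
  have : SmoothStrip T (fun q => (DX T u q) ^ 2 / 2 - DT T u q) :=
    ContDiffOn.sub (ContDiffOn.div_const (ContDiffOn.pow hp 2) 2) (h.smooth_u.dt h.hT)
  refine this.congr fun x t ht => ?_
  rw [h.hamilton_jacobi x t ht]; ring

lemma dx_F (h : LogSolution R T F F1 F2 u n) (x t : ℝ) (ht : t ∈ Icc 0 T) :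
    DX T (fun q => F (n q)) (x, t) = F1 (n (x, t)) * DX T n (x, t) :=
  h.smooth_F.dx_eq ht (fun _ => rfl)
    ((h.hF (n (x, t))).comp x (h.smooth_n.hasDerivAt_space ht x))

lemma dt_F (h : LogSolution R T F F1 F2 u n) (x t : ℝ) (ht : t ∈ Icc 0 T) :
    DT T (fun q => F (n q)) (x, t) = F1 (n (x, t)) * DT T n (x, t) :=
  h.smooth_F.dt_eq h.hT ht (fun _ _ => rfl)
    ((h.hF (n (x, t))).comp_hasDerivWithinAt t (h.smooth_n.hasDerivWithinAt_time ht x))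

lemma dt_dx_u (h : LogSolution R T F F1 F2 u n) (x t : ℝ) (ht : t ∈ Icc 0 T) :
    DT T (DX T u) (x, t) =
      DX T u (x, t) * DX T (DX T u) (x, t) - DX T (fun q => F (n q)) (x, t) := by
  rw [h.smooth_u.dt_dx h.hT ht]
  refine (h.smooth_u.dt h.hT).dx_eq ht (fun y => h.hamilton_jacobi y t ht) ?_
  have h1 := (h.smooth_u.dx h.hT).hasDerivAt_space ht x
  exact (((h1.pow 2).div_const 2).sub (h.smooth_F.hasDerivAt_space ht x)).congr_deriv
    (by push_cast; ring)

/-- The derivative of `F1 ∘ n` in space. -/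
lemma hasDerivAt_F1 (h : LogSolution R T F F1 F2 u n) (x t : ℝ) (ht : t ∈ Icc 0 T) :
    HasDerivAt (fun y => F1 (n (y, t))) (F2 (n (x, t)) * DX T n (x, t)) x :=
  (h.hF1 (n (x, t))).comp x (h.smooth_n.hasDerivAt_space ht x)

lemma dx_dx_F (h : LogSolution R T F F1 F2 u n) (x t : ℝ) (ht : t ∈ Icc 0 T) :
    DX T (DX T (fun q => F (n q))) (x, t) =
      F2 (n (x, t)) * DX T n (x, t) ^ 2 + F1 (n (x, t)) * DX T (DX T n) (x, t) := by
  refine (h.smooth_F.dx h.hT).dx_eq ht (fun y => h.dx_F y t ht) ?_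
  exact ((h.hasDerivAt_F1 x t ht).mul ((h.smooth_n.dx h.hT).hasDerivAt_space ht x)).congr_deriv
    (by ring)

lemma dx_dt_F (h : LogSolution R T F F1 F2 u n) (x t : ℝ) (ht : t ∈ Icc 0 T) :
    DX T (DT T (fun q => F (n q))) (x, t) =
      F2 (n (x, t)) * DX T n (x, t) * DT T n (x, t) + F1 (n (x, t)) * DX T (DT T n) (x, t) := by
  refine (h.smooth_F.dt h.hT).dx_eq ht (fun y => h.dt_F y t ht) ?_
  exact (h.hasDerivAt_F1 x t ht).mul ((h.smooth_n.dt h.hT).hasDerivAt_space ht x)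

lemma dx_dt_n (h : LogSolution R T F F1 F2 u n) (x t : ℝ) (ht : t ∈ Icc 0 T) :
    DX T (DT T n) (x, t) = DX T (DX T (DX T u)) (x, t)
      + DX T (DX T u) (x, t) * DX T n (x, t) + DX T u (x, t) * DX T (DX T n) (x, t) := by
  refine (h.smooth_n.dt h.hT).dx_eq ht (fun y => h.continuity y t ht) ?_
  have h1 := (h.smooth_u.dx h.hT).hasDerivAt_space ht x
  have h2 := ((h.smooth_u.dx h.hT).dx h.hT).hasDerivAt_space ht x
  exact (h2.add (h1.mul ((h.smooth_n.dx h.hT).hasDerivAt_space ht x))).congr_deriv (by ring)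

lemma dx_dt_dx_u (h : LogSolution R T F F1 F2 u n) (x t : ℝ) (ht : t ∈ Icc 0 T) :
    DX T (DT T (DX T u)) (x, t) = DX T (DX T u) (x, t) ^ 2
      + DX T u (x, t) * DX T (DX T (DX T u)) (x, t) - DX T (DX T (fun q => F (n q))) (x, t) := by
  have hp := h.smooth_u.dx h.hT
  refine (hp.dt h.hT).dx_eq ht (fun y => h.dt_dx_u y t ht) ?_
  have h1 := hp.hasDerivAt_space ht x
  have h2 := (hp.dx h.hT).hasDerivAt_space ht x
  exact ((h1.mul h2).sub ((h.smooth_F.dx h.hT).hasDerivAt_space ht x)).congr_deriv (by ring)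

lemma dt_dt_dx_u (h : LogSolution R T F F1 F2 u n) (x t : ℝ) (ht : t ∈ Icc 0 T) :
    DT T (DT T (DX T u)) (x, t) = DT T (DX T u) (x, t) * DX T (DX T u) (x, t)
      + DX T u (x, t) * DX T (DT T (DX T u)) (x, t) - DX T (DT T (fun q => F (n q))) (x, t) := by
  have hp := h.smooth_u.dx h.hT
  refine (hp.dt h.hT).dt_eq h.hT ht (fun s hs => h.dt_dx_u x s hs) ?_
  have h1 := hp.hasDerivWithinAt_time ht x
  have h2 := (hp.dx h.hT).hasDerivWithinAt_time ht x
  have h3 := (h.smooth_F.dx h.hT).hasDerivWithinAt_time ht x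
  rw [hp.dt_dx h.hT ht] at h2
  rw [h.smooth_F.dt_dx h.hT ht] at h3
  exact (h1.mul h2).sub h3

lemma dt_dt_n (h : LogSolution R T F F1 F2 u n) (x t : ℝ) (ht : t ∈ Icc 0 T) :
    DT T (DT T n) (x, t) = DX T (DT T (DX T u)) (x, t) + (DT T (DX T u) (x, t) * DX T n (x, t)
      + DX T u (x, t) * DX T (DT T n) (x, t)) := by
  have hp := h.smooth_u.dx h.hT
  refine (h.smooth_n.dt h.hT).dt_eq h.hT ht (fun s hs => h.continuity x s hs) ?_
  have h1 := hp.hasDerivWithinAt_time ht x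
  have h2 := (hp.dx h.hT).hasDerivWithinAt_time ht x
  have h3 := (h.smooth_n.dx h.hT).hasDerivWithinAt_time ht x
  rw [hp.dt_dx h.hT ht] at h2
  rw [h.smooth_n.dt_dx h.hT ht] at h3
  exact h2.add (h1.mul h3)

/-- Maximum principle for `σ n` with `σ = ±1`. -/
lemma extremum_n (h : LogSolution R T F F1 F2 u n) {σ b : ℝ} (hσ : σ ^ 2 = 1)
    (h0 : ∀ x, σ * n (x, 0) ≤ b) (h1 : ∀ x, σ * n (x, T) ≤ b) (x t : ℝ) (ht : t ∈ Icc 0 T) :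
    σ * n (x, t) ≤ b := by
  have hT := h.hT
  have key : ∀ ε : ℝ, 0 < ε → 2 * ε * T ^ 2 < 1 → σ * n (x, t) ≤ b + ε * T ^ 2 := by
    intro ε hε hεT
    set W : ℝ × ℝ → ℝ := fun q => σ * n q + ε * q.2 ^ 2 with hW
    have hWs : SmoothStrip T W :=
      ContDiffOn.add (ContDiffOn.mul contDiffOn_const h.smooth_n)
        (contDiff_const.mul (contDiff_snd.pow 2)).contDiffOn
    obtain ⟨y, s, hs, hmax⟩ := exists_max_of_periodic hT h.hR hWs.continuousOn (fun x t ht => by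
      simp [hW, h.periodic_n x t ht])
    obtain ⟨hx, ht0, htT, hess⟩ := hWs.maximum_conditions hT hs hmax
    have hle : σ * n (x, t) ≤ W (y, s) := by
      have := hmax (x, t) ht
      simp only [hW] at this ⊢
      nlinarith [mul_nonneg hε.le (sq_nonneg t)]
    have hsT : s ^ 2 ≤ T ^ 2 := by nlinarith [hs.1, hs.2]
    refine hle.trans ?_
    simp only [hW]
    rcases eq_or_lt_of_le hs.1 with e | hs0
    · subst e; nlinarith [h0 y, sq_nonneg T]
    rcases eq_or_lt_of_le hs.2 with e | hs1
    · subst e; nlinarith [h1 y]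
    exfalso
    have hd : ∀ y s, s ∈ Icc 0 T → DX T W (y, s) = σ * DX T n (y, s) := fun y s hs =>
      hWs.dx_eq hs (fun _ => rfl)
        (((h.smooth_n.hasDerivAt_space hs y).const_mul σ).add_const (ε * s ^ 2))
    have hdt : ∀ y s, s ∈ Icc 0 T → DT T W (y, s) = σ * DT T n (y, s) + 2 * ε * s := by
      intro y s hs
      refine hWs.dt_eq hT hs (fun _ _ => rfl) ?_
      have := ((hasDerivAt_pow 2 s).const_mul ε).hasDerivWithinAt (s := Icc 0 T)
      exact (((h.smooth_n.hasDerivWithinAt_time hs y).const_mul σ).add this).congr_deriv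
        (by push_cast; ring)
    have hxx : DX T (DX T W) (y, s) = σ * DX T (DX T n) (y, s) :=
      (hWs.dx hT).dx_eq hs (fun z => hd z s hs)
        (((h.smooth_n.dx hT).hasDerivAt_space hs y).const_mul σ)
    have hxt : DX T (DT T W) (y, s) = σ * DX T (DT T n) (y, s) :=
      (hWs.dt hT).dx_eq hs (fun z => hdt z s hs)
        ((((h.smooth_n.dt hT).hasDerivAt_space hs y).const_mul σ).add_const _)
    have htt : DT T (DT T W) (y, s) = σ * DT T (DT T n) (y, s) + 2 * ε := by
      refine (hWs.dt hT).dt_eq hT hs (fun r hr => hdt y r hr) ?_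
      have := ((hasDerivAt_id s).const_mul (2 * ε)).hasDerivWithinAt (s := Icc 0 T)
      exact ((((h.smooth_n.dt hT).hasDerivWithinAt_time hs y).const_mul σ).add this).congr_deriv
        (by ring)
    have e1 := hess hs0 hs1 (-DX T u (y, s)) 1
    have e2 := hess hs0 hs1 1 0
    rw [hxx, hxt, htt] at e1
    rw [hxx] at e2
    have et : σ * DT T n (y, s) + 2 * ε * s = 0 := by
      rw [← hdt y s hs]; exact le_antisymm (htT hs1) (ht0 hs0)
    have hσ0 : σ ≠ 0 := by rintro rfl; norm_num at hσ
    have ex : DX T n (y, s) = 0 := by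
      rw [hd y s hs] at hx
      exact (mul_eq_zero.1 hx).resolve_left hσ0
    have c1 := h.continuity y s hs
    have c2 := h.dx_dt_n y s hs
    have c3 := h.dt_dt_n y s hs
    have c4 := h.dx_dt_dx_u y s hs
    have c5 := h.dx_dx_F y s hs
    have hg := h.F1_pos (n (y, s))
    rw [ex] at c1 c2 c3 c5
    set nt := DT T n (y, s)
    set ntt := DT T (DT T n) (y, s)
    set nxt := DX T (DT T n) (y, s)
    set nxx := DX T (DX T n) (y, s)
    set p := DX T u (y, s)
    set px := DX T (DX T u) (y, s)
    set pxx := DX T (DX T (DX T u)) (y, s)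
    set g := F1 (n (y, s))
    have hQ : ntt - 2 * p * nxt + p ^ 2 * nxx + g * nxx = nt ^ 2 := by
      rw [c3, c4, c5, c1, c2]; ring
    have hsum : σ * nt ^ 2 + 2 * ε ≤ 0 := by
      rw [← hQ]
      have e2' : σ * nxx ≤ 0 := by linarith
      nlinarith [mul_nonneg hg.le (neg_nonneg.2 e2')]
    have hnt : nt ^ 2 = 4 * ε ^ 2 * s ^ 2 := by
      have : (σ * nt) ^ 2 = (2 * ε * s) ^ 2 := by rw [show σ * nt = -(2 * ε * s) by linarith]; ring
      rw [mul_pow, hσ] at this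
      linarith
    have hσ1 : -1 ≤ σ := by nlinarith
    have : 4 * ε ^ 2 * s ^ 2 ≤ 4 * ε ^ 2 * T ^ 2 := by
      apply mul_le_mul_of_nonneg_left hsT; positivity
    nlinarith [sq_nonneg nt, mul_pos hε hε]
  have hT2 : 0 < T ^ 2 := by positivity
  refine le_of_forall_pos_lt_add fun δ hδ => ?_
  set ε := min (δ / (2 * T ^ 2)) (1 / (4 * T ^ 2)) with hεdef
  have hε : 0 < ε := lt_min (by positivity) (by positivity)
  have a1 : ε * T ^ 2 ≤ δ / 2 := by
    calc ε * T ^ 2 ≤ δ / (2 * T ^ 2) * T ^ 2 := by gcongr; exact min_le_left _ _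
      _ = δ / 2 := by field_simp
  have a2 : ε * T ^ 2 ≤ 1 / 4 := by
    calc ε * T ^ 2 ≤ 1 / (4 * T ^ 2) * T ^ 2 := by gcongr; exact min_le_right _ _
      _ = 1 / 4 := by field_simp
  linarith [key ε hε (by linarith)]


end LogSolution

lemma exists_max_slice_of_periodic {T R : ℝ} (hR : 0 < R) {φ : ℝ × ℝ → ℝ}
    (hφ : ContinuousOn φ (strip T)) {t : ℝ} (ht : t ∈ Icc 0 T)
    (hper : ∀ x, φ (x + R, t) = φ (x, t)) : ∃ y, ∀ x, φ (x, t) ≤ φ (y, t) := by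
  have hc : ContinuousOn (fun y => φ (y, t)) (Icc 0 R) :=
    hφ.comp (by fun_prop) (fun y _ => ht)
  obtain ⟨y, -, hm⟩ := isCompact_Icc.exists_isMaxOn ⟨0, le_rfl, hR.le⟩ hc
  refine ⟨y, fun x => ?_⟩
  have hp : Function.Periodic (fun y => φ (y, t)) R := hper
  obtain ⟨x', hx', he⟩ := hp.exists_mem_Ico₀ hR x
  have : φ (x, t) = φ (x', t) := he
  rw [this]
  exact hm (a := x') ⟨hx'.1, hx'.2.le⟩

namespace SmoothStrip

variable {T : ℝ} {φ : ℝ × ℝ → ℝ}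

lemma affine (hφ : SmoothStrip T φ) (α β γ : ℝ) :
    SmoothStrip T (fun q => α * φ q + β * q.2 + γ) :=
  ContDiffOn.add (ContDiffOn.add (ContDiffOn.mul contDiffOn_const hφ)
    (contDiff_const.mul contDiff_snd).contDiffOn) contDiffOn_const

lemma dx_affine (hφ : SmoothStrip T φ) (α β γ x t : ℝ) (ht : t ∈ Icc 0 T) :
    DX T (fun q => α * φ q + β * q.2 + γ) (x, t) = α * DX T φ (x, t) :=
  (hφ.affine α β γ).dx_eq ht (fun _ => rfl)
    ((((hφ.hasDerivAt_space ht x).const_mul α).add_const (β * t)).add_const γ)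

lemma dt_affine (hT : 0 < T) (hφ : SmoothStrip T φ) (α β γ x t : ℝ) (ht : t ∈ Icc 0 T) :
    DT T (fun q => α * φ q + β * q.2 + γ) (x, t) = α * DT T φ (x, t) + β := by
  refine (hφ.affine α β γ).dt_eq hT ht (fun _ _ => rfl) ?_
  have := ((hasDerivAt_id t).const_mul β).hasDerivWithinAt (s := Icc 0 T)
  exact ((((hφ.hasDerivWithinAt_time ht x).const_mul α).add this).add_const γ).congr_deriv (by ring)

end SmoothStrip

namespace LogSolution

variable {R T M κ : ℝ} {F F1 F2 : ℝ → ℝ} {u n : ℝ × ℝ → ℝ}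

lemma exists_boundary_extremum (h : LogSolution R T F F1 F2 u n) {σ : ℝ} (hσ : σ ^ 2 = 1)
    (x t : ℝ) (ht : t ∈ Icc 0 T) :
    ∃ y s, (s = 0 ∨ s = T) ∧ σ * n (x, t) ≤ σ * n (y, s) := by
  have h0 : (0 : ℝ) ∈ Icc 0 T := ⟨le_rfl, h.hT.le⟩
  have h1 : T ∈ Icc 0 T := ⟨h.hT.le, le_rfl⟩
  have hs : ContinuousOn (fun q => σ * n q) (strip T) := h.smooth_n.continuousOn.const_smul σ
  obtain ⟨y0, hy0⟩ := exists_max_slice_of_periodic h.hR hs h0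
    (fun x => by simp only [h.periodic_n x 0 h0])
  obtain ⟨y1, hy1⟩ := exists_max_slice_of_periodic h.hR hs h1
    (fun x => by simp only [h.periodic_n x T h1])
  have := h.extremum_n hσ (b := max (σ * n (y0, 0)) (σ * n (y1, T)))
    (fun x => (hy0 x).trans (le_max_left _ _)) (fun x => (hy1 x).trans (le_max_right _ _)) x t ht
  rcases le_max_iff.1 this with h | h
  · exact ⟨y0, 0, Or.inl rfl, h⟩
  · exact ⟨y1, T, Or.inr rfl, h⟩

lemma strictMono_F (h : LogSolution R T F F1 F2 u n) : StrictMono F :=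
  strictMono_of_deriv_pos fun s => by rw [(h.hF s).deriv]; exact h.F1_pos s

lemma abs_F_le (h : LogSolution R T F F1 F2 u n) (h0 : ∀ x, |F (n (x, 0))| ≤ M)
    (h1 : ∀ x, |F (n (x, T))| ≤ M) (x t : ℝ) (ht : t ∈ Icc 0 T) : |F (n (x, t))| ≤ M := by
  have hb : ∀ y s, (s = 0 ∨ s = T) → |F (n (y, s))| ≤ M := by
    rintro y s (rfl | rfl)
    exacts [h0 y, h1 y]
  obtain ⟨y, s, hs, hle⟩ := h.exists_boundary_extremum (σ := 1) (by norm_num) x t ht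
  obtain ⟨y', s', hs', hle'⟩ := h.exists_boundary_extremum (σ := -1) (by norm_num) x t ht
  rw [abs_le]
  constructor
  · have := h.strictMono_F.monotone (show n (y', s') ≤ n (x, t) by linarith)
    linarith [(abs_le.1 (hb y' s' hs')).1]
  · have := h.strictMono_F.monotone (show n (x, t) ≤ n (y, s) by linarith)
    linarith [(abs_le.1 (hb y s hs)).2]

lemma u_le (h : LogSolution R T F F1 F2 u n) (hM : ∀ x t, t ∈ Icc 0 T → |F (n (x, t))| ≤ M)
    {a : ℝ} (ha : ∀ x, u (x, 0) ≤ a) (x t : ℝ) (ht : t ∈ Icc 0 T) : u (x, t) ≤ a + M * t := by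
  have key : ∀ ε, 0 < ε → u (x, t) ≤ a + M * t + ε * t := by
    intro ε hε
    obtain ⟨y, s, hs, hmax⟩ := exists_max_of_periodic h.hT h.hR
      (h.smooth_u.affine 1 (-(M + ε)) 0).continuousOn
      (fun x t ht => by simp only [h.periodic_u x t ht])
    obtain ⟨hx, ht0, -, -⟩ := (h.smooth_u.affine 1 (-(M + ε)) 0).maximum_conditions h.hT hs hmax
    rw [h.smooth_u.dx_affine _ _ _ _ _ hs, one_mul] at hx
    rw [h.smooth_u.dt_affine h.hT _ _ _ _ _ hs, h.hamilton_jacobi y s hs, hx] at ht0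
    have hs0 : s = 0 := by
      by_contra hne
      have := ht0 (lt_of_le_of_ne hs.1 (Ne.symm hne))
      linarith [(abs_le.1 (hM y s hs)).1]
    subst hs0
    have := hmax (x, t) ht
    simp only at this
    linarith [ha y]
  refine le_of_forall_pos_le_add fun δ hδ => ?_
  have h1 := key (δ / T) (div_pos hδ h.hT)
  have : δ / T * t ≤ δ / T * T := by
    apply mul_le_mul_of_nonneg_left ht.2 (div_pos hδ h.hT).le
  rw [div_mul_cancel₀ _ h.hT.ne'] at this
  linarith

lemma le_u (h : LogSolution R T F F1 F2 u n) (hM : ∀ x t, t ∈ Icc 0 T → |F (n (x, t))| ≤ M)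
    {a : ℝ} (ha : ∀ x, a ≤ u (x, T)) (x t : ℝ) (ht : t ∈ Icc 0 T) :
    a - M * (T - t) ≤ u (x, t) := by
  have key : ∀ ε, 0 < ε → a - M * (T - t) ≤ u (x, t) + ε * (T - t) := by
    intro ε hε
    obtain ⟨y, s, hs, hmax⟩ := exists_max_of_periodic h.hT h.hR
      (h.smooth_u.affine (-1) (M + ε) 0).continuousOn
      (fun x t ht => by simp only [h.periodic_u x t ht])
    obtain ⟨hx, -, ht0, -⟩ := (h.smooth_u.affine (-1) (M + ε) 0).maximum_conditions h.hT hs hmax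
    rw [h.smooth_u.dx_affine _ _ _ _ _ hs] at hx
    rw [h.smooth_u.dt_affine h.hT _ _ _ _ _ hs, h.hamilton_jacobi y s hs,
      show DX T u (y, s) = 0 by linarith] at ht0
    have hs0 : s = T := by
      by_contra hne
      have := ht0 (lt_of_le_of_ne hs.2 hne)
      linarith [(abs_le.1 (hM y s hs)).1]
    rw [hs0] at hmax
    have := hmax (x, t) ht
    simp only at this
    linarith [ha y]
  refine le_of_forall_pos_le_add fun δ hδ => ?_
  have h1 := key (δ / T) (div_pos hδ h.hT)
  have : δ / T * (T - t) ≤ δ / T * T := by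
    apply mul_le_mul_of_nonneg_left (by linarith [ht.1]) (div_pos hδ h.hT).le
  rw [div_mul_cancel₀ _ h.hT.ne'] at this
  linarith

/-- Comparison along straight lines (Hopf-Lax inequality). -/
lemma hopf_lax (h : LogSolution R T F F1 F2 u n) (hM : ∀ x t, t ∈ Icc 0 T → |F (n (x, t))| ≤ M)
    (x y : ℝ) : u (x, 0) ≤ u (y, T) + (R ^ 2 / (2 * T) + M * T) := by
  have hT := h.hT
  have hT1 : T ∈ Icc 0 T := ⟨hT.le, le_rfl⟩
  have hp : Function.Periodic (fun y => u (y, T)) R := fun y => h.periodic_u y T hT1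
  obtain ⟨y', hy', he⟩ := hp.exists_mem_Ico h.hR y x
  have he : u (y, T) = u (y', T) := he
  rw [he]
  set a := (y' - x) / T with ha
  set c := a ^ 2 / 2 + M with hc
  have hmono : MonotoneOn (fun r => u (x + a * r, 0 + 1 * r) + c * r) (Icc 0 T) := by
    apply monotoneOn_of_deriv_nonneg (convex_Icc 0 T)
    · refine ContinuousOn.add ?_ (by fun_prop)
      exact h.smooth_u.continuousOn.comp (by fun_prop) (fun r hr => by simpa [strip] using hr)
    · intro r hr
      rw [interior_Icc] at hr
      have hr' : 0 + 1 * r ∈ Ioo 0 T := by simpa using hr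
      exact ((h.smooth_u.hasDerivAt_line (x := x) (a := a) hr').add
        ((hasDerivAt_id r).const_mul c)).differentiableAt.differentiableWithinAt
    · intro r hr
      rw [interior_Icc] at hr
      have hr' : 0 + 1 * r ∈ Ioo 0 T := by simpa using hr
      have hd := ((h.smooth_u.hasDerivAt_line (x := x) (a := a) hr').add
        ((hasDerivAt_id r).const_mul c)).deriv
      have hI : 0 + 1 * r ∈ Icc 0 T := ⟨hr'.1.le, hr'.2.le⟩
      refine le_of_le_of_eq ?_ hd.symm
      rw [h.hamilton_jacobi _ _ hI]
      have := (abs_le.1 (hM (x + a * r) _ hI)).2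
      nlinarith [sq_nonneg (a + DX T u (x + a * r, 0 + 1 * r))]
  have := hmono ⟨le_rfl, hT.le⟩ hT1 hT.le
  have e1 : x + a * T = y' := by rw [ha]; field_simp; ring
  simp only [mul_zero, add_zero, one_mul, zero_add, e1] at this
  have e2 : c * T ≤ R ^ 2 / (2 * T) + M * T := by
    have : (y' - x) ^ 2 ≤ R ^ 2 := by
      have := hy'.1; have := hy'.2
      apply pow_le_pow_left₀ <;> linarith
    have e3 : c * T = (y' - x) ^ 2 / (2 * T) + M * T := by rw [hc, ha]; field_simp
    rw [e3]; gcongr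
  linarith

/-- Oscillation bound for `u`, normalised by its maximum `a` at the initial time. -/
lemma exists_u_bounds (h : LogSolution R T F F1 F2 u n)
    (hM : ∀ x t, t ∈ Icc 0 T → |F (n (x, t))| ≤ M) :
    ∃ a, (∀ x, u (x, 0) ≤ a) ∧ (∀ x, a - (R ^ 2 / (2 * T) + M * T) ≤ u (x, T)) ∧
      (∀ x t, t ∈ Icc 0 T → u (x, t) ≤ a + M * t) ∧
      (∀ x t, t ∈ Icc 0 T → a - (R ^ 2 / (2 * T) + M * T) - M * (T - t) ≤ u (x, t)) := by
  have h0 : (0 : ℝ) ∈ Icc 0 T := ⟨le_rfl, h.hT.le⟩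
  obtain ⟨y, hy⟩ := exists_max_slice_of_periodic h.hR h.smooth_u.continuousOn h0
    (fun x => h.periodic_u x 0 h0)
  have h2 : ∀ x, u (y, 0) - (R ^ 2 / (2 * T) + M * T) ≤ u (x, T) := fun x => by
    linarith [h.hopf_lax hM y x]
  exact ⟨u (y, 0), hy, h2, h.u_le hM hy, h.le_u hM h2⟩

end LogSolution

/-- Bound for the size of the shifted value function used in the gradient estimate. -/
noncomputable def valueBound (R T M : ℝ) : ℝ := R ^ 2 / (2 * T) + 2 * M * T + 1

/-- Time slope of the shifted value function used in the gradient estimate. -/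
noncomputable def timeSlope (R T M : ℝ) : ℝ := (R ^ 2 / (2 * T) + M * T + 2) / T

/-- Bound for `(∂ₓu)²`. -/
noncomputable def gradientBound (κ R T M : ℝ) : ℝ :=
  2 * (2 * (M + timeSlope R T M + M ^ 2) + (3 + κ) * valueBound R T M ^ 2) + valueBound R T M ^ 2

namespace LogSolution

variable {R T M κ : ℝ} {F F1 F2 : ℝ → ℝ} {u n : ℝ × ℝ → ℝ}

lemma interior_algebra {κ Z M k p px pt v vx g gx z : ℝ} (hκ : 0 < κ) (hp : p ≠ 0) (hg : 0 < g)
    (hM : |v| ≤ M) (hM0 : 0 < M) (hk : 0 < k) (hz : |z| ≤ Z) (hgx : |gx| ≤ (1 + κ) * |vx|)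
    (hpt : pt = p * px - vx)
    (hx : p * px + z * p = 0) (ht : p * pt + z * (p ^ 2 / 2 - v + k) = 0)
    (hQ : -(p * (gx + 2 * vx) * px) + vx ^ 2 + g * px ^ 2 + (p ^ 2 / 2 + v - k) ^ 2 + g * p ^ 2 ≤ 0) :
    p ^ 2 / 2 ≤ 2 * (M + k + M ^ 2) + (3 + κ) * Z ^ 2 := by
  have hpx : px = -z := by
    have : p * (px + z) = 0 := by linarith
    have := (mul_eq_zero.1 this).resolve_left hp
    linarith
  have hv := abs_le.1 hM
  set e := p ^ 2 / 2 + v - k with he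
  by_contra! hcon
  have hZ2 : z ^ 2 ≤ Z ^ 2 := sq_le_sq' (by linarith [(abs_le.1 hz).1]) (abs_le.1 hz).2
  have hepos : (3 + κ) * Z ^ 2 < e := by rw [he]; nlinarith
  have he0 : 0 < e := lt_of_le_of_lt (by positivity) hepos
  have hvx : p * vx = -(z * e) := by
    subst hpt; rw [hpx] at ht; rw [he]; linarith
  have habs : |p * (gx + 2 * vx) * px| ≤ (3 + κ) * Z ^ 2 * e := by
    have h1 : |gx + 2 * vx| ≤ (3 + κ) * |vx| := by
      calc |gx + 2 * vx| ≤ |gx| + |2 * vx| := abs_add_le _ _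
        _ ≤ (1 + κ) * |vx| + 2 * |vx| := by rw [abs_mul, abs_two]; linarith
        _ = _ := by ring
    calc |p * (gx + 2 * vx) * px| = |p| * |gx + 2 * vx| * |z| := by
          rw [abs_mul, abs_mul, hpx, abs_neg]
      _ ≤ |p| * ((3 + κ) * |vx|) * |z| := by gcongr
      _ = (3 + κ) * |p * vx| * |z| := by rw [abs_mul]; ring
      _ = (3 + κ) * (|z| ^ 2) * e := by rw [hvx, abs_neg, abs_mul, abs_of_pos he0]; ring
      _ ≤ (3 + κ) * Z ^ 2 * e := by rw [sq_abs]; gcongr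
  have h2 := (abs_le.1 habs).2
  have h3 : (3 + κ) * Z ^ 2 * e < e ^ 2 := by nlinarith
  nlinarith [sq_nonneg vx, mul_nonneg hg.le (sq_nonneg px), mul_nonneg hg.le (sq_nonneg p)]

lemma boundary_algebra {M k p v b : ℝ} (hv : |v| ≤ M) (hb : |b| ≤ M)
    (h : p ^ 2 / 2 + v - k ≤ p * b) : p ^ 2 / 2 ≤ 2 * (M + k + M ^ 2) := by
  have h1 := abs_le.1 hv
  have h2 : b ^ 2 ≤ M ^ 2 := sq_le_sq' (abs_le.1 hb).1 (abs_le.1 hb).2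
  nlinarith [sq_nonneg (p / 2 - b)]

/-- Gradient estimate for `u`. -/
lemma sq_dx_u_le (h : LogSolution R T F F1 F2 u n) (hκ : 0 < κ) (hM0 : 0 < M)
    (hM : ∀ x t, t ∈ Icc 0 T → |F (n (x, t))| ≤ M)
    (h0 : ∀ x, |DX T (fun q => F (n q)) (x, 0)| ≤ M)
    (h1 : ∀ x, |DX T (fun q => F (n q)) (x, T)| ≤ M)
    (hF2 : ∀ x t, t ∈ Icc 0 T → |F2 (n (x, t))| ≤ (1 + κ) * F1 (n (x, t)))
    (x t : ℝ) (ht : t ∈ Icc 0 T) : (DX T u (x, t)) ^ 2 ≤ gradientBound κ R T M := by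
  have hT := h.hT
  obtain ⟨a, ha0, haT, hup, hlow⟩ := h.exists_u_bounds hM
  set k := timeSlope R T M with hk
  set Z := valueBound R T M with hZ
  have hkT : k * T = R ^ 2 / (2 * T) + M * T + 2 := by
    rw [hk, timeSlope, div_mul_cancel₀ _ hT.ne']
  have hB0 : 0 ≤ R ^ 2 / (2 * T) := by positivity
  have hMT : 0 < M * T := by positivity
  have hkpos : 0 < k := by rw [hk, timeSlope]; positivity
  set z : ℝ × ℝ → ℝ := fun q => 1 * u q + k * q.2 + (-a - 1) with hz
  have hzs : SmoothStrip T z := h.smooth_u.affine _ _ _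
  have hps := h.smooth_u.dx hT
  have hzx : ∀ x t, t ∈ Icc 0 T → DX T z (x, t) = DX T u (x, t) := fun x t ht => by
    rw [hz, h.smooth_u.dx_affine _ _ _ _ _ ht, one_mul]
  have hzt : ∀ x t, t ∈ Icc 0 T → DT T z (x, t) = DT T u (x, t) + k := fun x t ht => by
    rw [hz, h.smooth_u.dt_affine hT _ _ _ _ _ ht, one_mul]
  have hzb : ∀ x t, t ∈ Icc 0 T → |z (x, t)| ≤ Z := by
    intro x t ht
    have h1 := hup x t ht
    have h2 := hlow x t ht
    have h3 : M * t ≤ M * T := mul_le_mul_of_nonneg_left ht.2 hM0.le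
    have h4 : k * t ≤ k * T := mul_le_mul_of_nonneg_left ht.2 hkpos.le
    have h5 : 0 ≤ M * t := mul_nonneg hM0.le ht.1
    have h6 : 0 ≤ k * t := mul_nonneg hkpos.le ht.1
    rw [abs_le, hZ, valueBound]
    simp only [hz]
    constructor <;> linarith
  set W : ℝ × ℝ → ℝ := fun q => DX T u q ^ 2 / 2 + z q ^ 2 / 2 with hW
  have hWs : SmoothStrip T W := ContDiffOn.add (ContDiffOn.div_const (ContDiffOn.pow hps 2) 2)
    (ContDiffOn.div_const (ContDiffOn.pow hzs 2) 2)
  have hWx : ∀ x t, t ∈ Icc 0 T → DX T W (x, t) =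
      DX T u (x, t) * DX T (DX T u) (x, t) + z (x, t) * DX T u (x, t) := fun x t ht =>
    hWs.dx_eq ht (fun _ => rfl) (((((hps.hasDerivAt_space ht x).pow 2).div_const 2).add
      (((hzs.hasDerivAt_space ht x).pow 2).div_const 2)).congr_deriv
        (by rw [hzx x t ht]; push_cast; ring))
  have hWt : ∀ x t, t ∈ Icc 0 T → DT T W (x, t) =
      DX T u (x, t) * DT T (DX T u) (x, t) + z (x, t) * (DT T u (x, t) + k) := fun x t ht =>
    hWs.dt_eq hT ht (fun _ _ => rfl) (((((hps.hasDerivWithinAt_time ht x).pow 2).div_const 2).add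
      (((hzs.hasDerivWithinAt_time ht x).pow 2).div_const 2)).congr_deriv
        (by rw [hzt x t ht]; push_cast; ring))
  obtain ⟨y, s, hs, hmax⟩ := exists_max_of_periodic hT h.hR hWs.continuousOn (fun x t ht => by
    simp only [hW, hz, h.periodic_u x t ht, h.smooth_u.periodic_dx h.periodic_u x t ht])
  suffices hcl : (DX T u (y, s)) ^ 2 / 2 ≤ 2 * (M + k + M ^ 2) + (3 + κ) * Z ^ 2 by
    have hle := hmax (x, t) ht
    simp only [hW] at hle
    have hz2 : z (y, s) ^ 2 ≤ Z ^ 2 :=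
      sq_le_sq' (by linarith [(abs_le.1 (hzb y s hs)).1]) (abs_le.1 (hzb y s hs)).2
    rw [gradientBound]
    nlinarith [sq_nonneg (z (x, t))]
  obtain ⟨hx, ht0, htT, hess⟩ := hWs.maximum_conditions hT hs hmax
  rw [hWx y s hs] at hx
  rw [hWt y s hs] at ht0 htT
  have hKZ : 0 ≤ (3 + κ) * Z ^ 2 := by positivity
  by_cases hp0 : DX T u (y, s) = 0
  · rw [hp0]; nlinarith
  have hpx : DX T (DX T u) (y, s) = -z (y, s) := by
    have : DX T u (y, s) * (DX T (DX T u) (y, s) + z (y, s)) = 0 := by linarith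
    linarith [(mul_eq_zero.1 this).resolve_left hp0]
  rcases eq_or_lt_of_le hs.1 with e | hs0
  · subst e
    have hd := htT hT
    rw [h.dt_dx_u y 0 hs, hpx, h.hamilton_jacobi y 0 hs] at hd
    have hz1 : z (y, 0) ≤ -1 := by simp only [hz]; linarith [ha0 y]
    by_cases hc : DX T u (y, 0) ^ 2 / 2 + F (n (y, 0)) - k ≤ 0
    · have := boundary_algebra (b := 0) (hM y 0 hs) (by simpa using hM0.le)
        (p := DX T u (y, 0)) (k := k) (by linarith)
      linarith
    · have := boundary_algebra (b := DX T (fun q => F (n q)) (y, 0)) (hM y 0 hs) (h0 y)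
        (p := DX T u (y, 0)) (k := k) (by nlinarith)
      linarith
  rcases eq_or_lt_of_le hs.2 with e | hs1
  · subst e
    have hd := ht0 hT
    rw [h.dt_dx_u y s hs, hpx, h.hamilton_jacobi y s hs] at hd
    have hz1 : 1 ≤ z (y, s) := by simp only [hz]; linarith [haT y]
    by_cases hc : DX s u (y, s) ^ 2 / 2 + F (n (y, s)) - k ≤ 0
    · have := boundary_algebra (b := 0) (hM y s hs) (by simpa using hM0.le)
        (p := DX s u (y, s)) (k := k) (by linarith)
      linarith
    · have := boundary_algebra (b := -DX s (fun q => F (n q)) (y, s)) (hM y s hs)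
        (by rw [abs_neg]; exact h1 y) (p := DX s u (y, s)) (k := k) (by nlinarith)
      linarith
  have hWxx : DX T (DX T W) (y, s) = DX T (DX T u) (y, s) ^ 2
      + DX T u (y, s) * DX T (DX T (DX T u)) (y, s) + DX T u (y, s) ^ 2
      + z (y, s) * DX T (DX T u) (y, s) := by
    refine (hWs.dx hT).dx_eq hs (fun x => hWx x s hs) ?_
    have d1 := hps.hasDerivAt_space hs y
    have d2 := (hps.dx hT).hasDerivAt_space hs y
    have d3 := hzs.hasDerivAt_space hs y
    exact ((d1.mul d2).add (d3.mul d1)).congr_deriv (by rw [hzx y s hs]; ring)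
  have hWxt : DX T (DT T W) (y, s) = DX T (DX T u) (y, s) * DT T (DX T u) (y, s)
      + DX T u (y, s) * DX T (DT T (DX T u)) (y, s) + DX T u (y, s) * (DT T u (y, s) + k)
      + z (y, s) * DT T (DX T u) (y, s) := by
    refine (hWs.dt hT).dx_eq hs (fun x => hWt x s hs) ?_
    have d1 := hps.hasDerivAt_space hs y
    have d2 := (hps.dt hT).hasDerivAt_space hs y
    have d3 := hzs.hasDerivAt_space hs y
    have d4 := ((h.smooth_u.dt hT).hasDerivAt_space hs y).add_const k
    exact ((d1.mul d2).add (d3.mul d4)).congr_deriv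
      (by rw [hzx y s hs, h.smooth_u.dt_dx hT hs]; ring)
  have hutt : DT T (DT T u) (y, s) = DX T u (y, s) * DT T (DX T u) (y, s)
      - DT T (fun q => F (n q)) (y, s) := by
    refine (h.smooth_u.dt hT).dt_eq hT hs (fun r hr => h.hamilton_jacobi y r hr) ?_
    exact (((hps.hasDerivWithinAt_time hs y).pow 2).div_const 2).sub
      (h.smooth_F.hasDerivWithinAt_time hs y) |>.congr_deriv (by push_cast; ring)
  have hWtt : DT T (DT T W) (y, s) = DT T (DX T u) (y, s) ^ 2
      + DX T u (y, s) * DT T (DT T (DX T u)) (y, s) + (DT T u (y, s) + k) ^ 2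
      + z (y, s) * DT T (DT T u) (y, s) := by
    refine (hWs.dt hT).dt_eq hT hs (fun r hr => hWt y r hr) ?_
    have d1 := hps.hasDerivWithinAt_time hs y
    have d2 := (hps.dt hT).hasDerivWithinAt_time hs y
    have d3 := hzs.hasDerivWithinAt_time hs y
    have d4 := ((h.smooth_u.dt hT).hasDerivWithinAt_time hs y).add_const k
    exact ((d1.mul d2).add (d3.mul d4)).congr_deriv (by rw [hzt y s hs]; ring)
  have hg := h.F1_pos (n (y, s))
  have e1 := hess hs0 hs1 (-DX T u (y, s)) 1
  have e2 := hess hs0 hs1 1 0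
  have hdt := le_antisymm (htT hs1) (ht0 hs0)
  rw [hWxx, hWxt, hWtt, hutt, h.dt_dt_dx_u y s hs, h.dx_dt_dx_u y s hs, h.dx_dx_F y s hs,
    h.dx_dt_F y s hs, h.dx_dt_n y s hs, h.dt_F y s hs, h.continuity y s hs, h.dt_dx_u y s hs,
    h.hamilton_jacobi y s hs, h.dx_F y s hs] at e1
  rw [hWxx] at e2
  rw [h.hamilton_jacobi y s hs] at hdt
  refine interior_algebra (px := DX T (DX T u) (y, s)) (g := F1 (n (y, s)))
    (gx := F2 (n (y, s)) * DX T n (y, s)) (vx := F1 (n (y, s)) * DX T n (y, s))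
    hκ hp0 hg (hM y s hs) hM0 hkpos (hzb y s hs) ?_
    ((h.dt_dx_u y s hs).trans (by rw [h.dx_F y s hs])) hx hdt ?_
  · rw [abs_mul, abs_mul, abs_of_pos hg, ← mul_assoc]
    exact mul_le_mul_of_nonneg_right (hF2 y s hs) (abs_nonneg _)
  · generalize F2 (n (y, s)) = g2 at *
    generalize F1 (n (y, s)) = g at *
    generalize DX T n (y, s) = nx at *
    generalize DX T (DX T n) (y, s) = nxx at *
    generalize DX T (DX T (DX T u)) (y, s) = pxx at *
    generalize DX T (DX T u) (y, s) = px at *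
    generalize DX T u (y, s) = p at *
    generalize F (n (y, s)) = v at *
    generalize z (y, s) = ζ at *
    have e3 := mul_nonneg hg.le (neg_nonneg.2 e2)
    linarith only [e1, e3]

end LogSolution


section Integrals

open MeasureTheory

variable {T R : ℝ} {φ ψ : ℝ × ℝ → ℝ}

lemma continuous_slice (hφ : ContinuousOn φ (strip T)) {t : ℝ} (ht : t ∈ Icc 0 T) :
    Continuous (fun x => φ (x, t)) :=
  hφ.comp_continuous (by fun_prop) fun _ => ht

lemma continuous_clamp (hT : 0 < T) (hφ : ContinuousOn φ (strip T)) :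
    Continuous (fun q : ℝ × ℝ => φ (q.1, max 0 (min q.2 T))) :=
  hφ.comp_continuous (by fun_prop) fun q =>
    mem_strip.2 ⟨le_max_left _ _, max_le hT.le (min_le_right _ _)⟩

lemma clamp_eq {t : ℝ} (ht : t ∈ Icc 0 T) : max 0 (min t T) = t := by
  rw [min_eq_left ht.2, max_eq_right ht.1]

lemma intervalIntegrable_integral_slice (hT : 0 < T) (hφ : ContinuousOn φ (strip T)) :
    IntervalIntegrable (fun t => ∫ x in (0 : ℝ)..R, φ (x, t)) volume 0 T := by
  have hc : Continuous (fun t => ∫ x in (0 : ℝ)..R, φ (x, max 0 (min t T))) :=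
    intervalIntegral.continuous_parametric_intervalIntegral_of_continuous
      (f := fun t x => φ (x, max 0 (min t T)))
      ((continuous_clamp hT hφ).comp continuous_swap) continuous_const
  refine (hc.intervalIntegrable 0 T).congr fun t ht => ?_
  rw [uIoc_of_le hT.le] at ht
  simp only [clamp_eq (Ioc_subset_Icc_self ht)]

lemma integral_integral_mono (hT : 0 < T) (hR : 0 < R) (hφ : ContinuousOn φ (strip T))
    (hψ : ContinuousOn ψ (strip T)) (hle : ∀ x t, t ∈ Icc 0 T → φ (x, t) ≤ ψ (x, t)) :
    ∫ t in (0 : ℝ)..T, ∫ x in (0 : ℝ)..R, φ (x, t) ≤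
      ∫ t in (0 : ℝ)..T, ∫ x in (0 : ℝ)..R, ψ (x, t) :=
  intervalIntegral.integral_mono_on hT.le (intervalIntegrable_integral_slice hT hφ)
    (intervalIntegrable_integral_slice hT hψ) fun t ht =>
      intervalIntegral.integral_mono_on hR.le ((continuous_slice hφ ht).intervalIntegrable _ _)
        ((continuous_slice hψ ht).intervalIntegrable _ _) fun x _ => hle x t ht

lemma SmoothStrip.integral_dx_eq_zero (hT : 0 < T) (hφ : SmoothStrip T φ)
    (hper : ∀ x t, t ∈ Icc 0 T → φ (x + R, t) = φ (x, t)) {t : ℝ} (ht : t ∈ Icc 0 T) :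
    ∫ x in (0 : ℝ)..R, DX T φ (x, t) = 0 := by
  rw [intervalIntegral.integral_eq_sub_of_hasDerivAt (fun x _ => hφ.hasDerivAt_space ht x)
    ((continuous_slice (hφ.dx hT).continuousOn ht).intervalIntegrable _ _)]
  have := hper 0 t ht
  rw [zero_add] at this
  rw [this, sub_self]

lemma SmoothStrip.integral_integral_dt (hT : 0 < T) (hφ : SmoothStrip T φ) :
    ∫ t in (0 : ℝ)..T, ∫ x in (0 : ℝ)..R, DT T φ (x, t) =
      ∫ x in (0 : ℝ)..R, (φ (x, T) - φ (x, 0)) := by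
  have hc := continuous_clamp hT (hφ.dt hT).continuousOn
  have e1 : ∫ t in (0 : ℝ)..T, ∫ x in (0 : ℝ)..R, DT T φ (x, t) =
      ∫ t in (0 : ℝ)..T, ∫ x in (0 : ℝ)..R, DT T φ (x, max 0 (min t T)) := by
    refine intervalIntegral.integral_congr fun t ht => ?_
    rw [uIcc_of_le hT.le] at ht
    simp only [clamp_eq ht]
  rw [e1, intervalIntegral_intervalIntegral_swap
    (F := fun t x => DT T φ (x, max 0 (min t T)))]
  · refine intervalIntegral.integral_congr fun x _ => ?_
    refine intervalIntegral.integral_eq_sub_of_hasDerivAt_of_le hT.le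
      (f := fun t => φ (x, t)) ?_ ?_ ?_
    · exact hφ.continuousOn.comp (by fun_prop) fun t ht => ht
    · intro t ht
      have hI : t ∈ Icc 0 T := Ioo_subset_Icc_self ht
      simp only [clamp_eq hI]
      exact (hφ.hasDerivWithinAt_time hI x).hasDerivAt (Icc_mem_nhds ht.1 ht.2)
    · exact (hc.comp (by fun_prop : Continuous fun t : ℝ => (x, t))).intervalIntegrable _ _
  · have : Continuous (Function.uncurry fun t x => DT T φ (x, max 0 (min t T))) :=
      hc.comp continuous_swap
    exact (this.continuousOn.integrableOn_compact (isCompact_uIcc.prod isCompact_uIcc)).mono_set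
      (prod_mono uIoc_subset_uIcc uIoc_subset_uIcc)

end Integrals

namespace LogSolution

variable {R T M κ : ℝ} {F F1 F2 : ℝ → ℝ} {u n : ℝ × ℝ → ℝ}

/-- Energy identity in divergence form. -/
lemma divergence_identity (h : LogSolution R T F F1 F2 u n) (x t : ℝ) (ht : t ∈ Icc 0 T) :
    DX T (fun q => DX T u q * DT T (fun q => F (n q)) q) (x, t)
        - DT T (fun q => DX T (fun q => F (n q)) q * DX T u q) (x, t) =
      F1 (n (x, t)) * DX T (DX T u) (x, t) ^ 2 + DX T (fun q => F (n q)) (x, t) ^ 2 := by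
  have hp := h.smooth_u.dx h.hT
  have hv := h.smooth_F
  have hA : SmoothStrip T (fun q => DX T u q * DT T (fun q => F (n q)) q) :=
    ContDiffOn.mul hp (hv.dt h.hT)
  have hB : SmoothStrip T (fun q => DX T (fun q => F (n q)) q * DX T u q) :=
    ContDiffOn.mul (hv.dx h.hT) hp
  rw [hA.dx_eq ht (fun _ => rfl)
      ((hp.hasDerivAt_space ht x).mul ((hv.dt h.hT).hasDerivAt_space ht x)),
    hB.dt_eq h.hT ht (fun _ _ => rfl)
      (((hv.dx h.hT).hasDerivWithinAt_time ht x).mul (hp.hasDerivWithinAt_time ht x)),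
    hv.dt_dx h.hT ht, h.dt_dx_u x t ht, h.dt_F x t ht, h.continuity x t ht, h.dx_F x t ht]
  ring

lemma energy_le (h : LogSolution R T F F1 F2 u n) {G : ℝ} (hM0 : 0 < M) (hκ : 0 < κ)
    (hG : ∀ x t, t ∈ Icc 0 T → (DX T u (x, t)) ^ 2 ≤ G)
    (h0 : ∀ x, |DX T (fun q => F (n q)) (x, 0)| ≤ M)
    (h1 : ∀ x, |DX T (fun q => F (n q)) (x, T)| ≤ M)
    (hF1 : ∀ x t, t ∈ Icc 0 T → F1 (n (x, t)) ≤ κ) :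
    ∫ t in (0 : ℝ)..T, ∫ x in (0 : ℝ)..R,
      (DX T (fun q => F (n q)) (x, t) ^ 2 + DT T (fun q => F (n q)) (x, t) ^ 2) ≤
      (1 + 2 * G + 2 * κ) * (2 * (M * (G + 1)) * R) := by
  have hT := h.hT
  have hp := h.smooth_u.dx hT
  have hv := h.smooth_F
  have h0T : (0 : ℝ) ∈ Icc 0 T := ⟨le_rfl, hT.le⟩
  have hTT : T ∈ Icc 0 T := ⟨hT.le, le_rfl⟩
  have hG0 : 0 ≤ G := (sq_nonneg _).trans (hG 0 0 h0T)
  set K := 1 + 2 * G + 2 * κ with hK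
  have hK0 : 0 ≤ K := by positivity
  set A : ℝ × ℝ → ℝ := fun q => DX T u q * DT T (fun q => F (n q)) q with hAdef
  set B : ℝ × ℝ → ℝ := fun q => DX T (fun q => F (n q)) q * DX T u q with hBdef
  have hA : SmoothStrip T A := ContDiffOn.mul hp (hv.dt hT)
  have hB : SmoothStrip T B := ContDiffOn.mul (hv.dx hT) hp
  have hAper : ∀ x t, t ∈ Icc 0 T → A (x + R, t) = A (x, t) := fun x t ht => by
    simp only [hAdef]
    rw [h.smooth_u.periodic_dx h.periodic_u x t ht,
      hv.periodic_dt hT (fun x t ht => by rw [h.periodic_n x t ht]) x t ht]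
  have hle : ∀ x t, t ∈ Icc 0 T →
      DX T (fun q => F (n q)) (x, t) ^ 2 + DT T (fun q => F (n q)) (x, t) ^ 2 ≤
        K * (DX T A (x, t) - DT T B (x, t)) := by
    intro x t ht
    rw [hAdef, hBdef, h.divergence_identity x t ht]
    have hvt : DT T (fun q => F (n q)) (x, t) = DX T u (x, t) * DX T (fun q => F (n q)) (x, t)
        + F1 (n (x, t)) * DX T (DX T u) (x, t) := by
      rw [h.dt_F x t ht, h.continuity x t ht, h.dx_F x t ht]; ring
    rw [hvt]
    have hg := h.F1_pos (n (x, t))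
    have hgκ := hF1 x t ht
    have hpG := hG x t ht
    generalize F1 (n (x, t)) = g at *
    generalize DX T (fun q => F (n q)) (x, t) = vx at *
    generalize DX T (DX T u) (x, t) = px at *
    generalize DX T u (x, t) = p at *
    have e1 : (p * vx + g * px) ^ 2 ≤ 2 * (p ^ 2 * vx ^ 2) + 2 * (g * (g * px ^ 2)) := by
      nlinarith [sq_nonneg (p * vx - g * px)]
    have e2 : p ^ 2 * vx ^ 2 ≤ G * vx ^ 2 := by gcongr
    have e3 : g * (g * px ^ 2) ≤ κ * (g * px ^ 2) := by gcongr
    have e4 : 0 ≤ g * px ^ 2 := by positivity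
    have e5 : 0 ≤ (1 + 2 * G) * (g * px ^ 2) := by positivity
    have e6 : 0 ≤ κ * vx ^ 2 := by positivity
    rw [hK]
    linarith
  have hcont : ContinuousOn (fun q => DX T A q - DT T B q) (strip T) :=
    (hA.dx hT).continuousOn.sub (hB.dt hT).continuousOn
  refine (integral_integral_mono hT h.hR
    (φ := fun q => DX T (fun q => F (n q)) q ^ 2 + DT T (fun q => F (n q)) q ^ 2)
    (ψ := fun q => K * (DX T A q - DT T B q))
    (((hv.dx hT).continuousOn.pow 2).add ((hv.dt hT).continuousOn.pow 2))
    (continuousOn_const.mul hcont) hle).trans ?_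
  have e1 : ∫ t in (0 : ℝ)..T, ∫ x in (0 : ℝ)..R, K * (DX T A (x, t) - DT T B (x, t)) =
      ∫ t in (0 : ℝ)..T, -K * ∫ x in (0 : ℝ)..R, DT T B (x, t) := by
    refine intervalIntegral.integral_congr fun t ht => ?_
    rw [uIcc_of_le hT.le] at ht
    rw [intervalIntegral.integral_const_mul, intervalIntegral.integral_sub
      ((continuous_slice (hA.dx hT).continuousOn ht).intervalIntegrable _ _)
      ((continuous_slice (hB.dt hT).continuousOn ht).intervalIntegrable _ _),
      hA.integral_dx_eq_zero hT hAper ht]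
    ring
  have hBle : ∀ x t, t ∈ Icc 0 T → |DX T (fun q => F (n q)) (x, t)| ≤ M →
      |B (x, t)| ≤ M * (G + 1) := by
    intro x t ht hb
    have : |DX T u (x, t)| ≤ G + 1 := by
      have := hG x t ht
      rw [← sq_abs] at this
      nlinarith [sq_nonneg (|DX T u (x, t)| - 1)]
    simp only [hBdef, abs_mul]
    gcongr
  have e2 : |∫ x in (0 : ℝ)..R, (B (x, T) - B (x, 0))| ≤ 2 * (M * (G + 1)) * R := by
    have := intervalIntegral.norm_integral_le_of_norm_le_const (a := 0) (b := R)
      (f := fun x => B (x, T) - B (x, 0)) (C := 2 * (M * (G + 1))) (fun x _ => by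
        rw [Real.norm_eq_abs]
        have a1 := abs_le.1 (hBle x T hTT (h1 x))
        have a2 := abs_le.1 (hBle x 0 h0T (h0 x))
        rw [abs_le]; constructor <;> linarith [a1.1, a1.2, a2.1, a2.2])
    rwa [Real.norm_eq_abs, sub_zero, abs_of_pos h.hR] at this
  rw [e1, intervalIntegral.integral_const_mul, hB.integral_integral_dt hT]
  have := (abs_le.1 e2).1
  nlinarith

/-- The energy estimate for the logarithmic formulation. -/
lemma energy_estimate (h : LogSolution R T F F1 F2 u n) (hM0 : 0 < M) (hκ : 0 < κ)
    (hv0 : ∀ x, |F (n (x, 0))| ≤ M) (hvT : ∀ x, |F (n (x, T))| ≤ M)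
    (h0 : ∀ x, |DX T (fun q => F (n q)) (x, 0)| ≤ M)
    (h1 : ∀ x, |DX T (fun q => F (n q)) (x, T)| ≤ M)
    (hF1 : ∀ x t, t ∈ Icc 0 T → F1 (n (x, t)) ≤ κ)
    (hF2 : ∀ x t, t ∈ Icc 0 T → |F2 (n (x, t))| ≤ (1 + κ) * F1 (n (x, t))) :
    ∫ t in (0 : ℝ)..T, ∫ x in (0 : ℝ)..R,
      (DX T (fun q => F (n q)) (x, t) ^ 2 + DT T (fun q => F (n q)) (x, t) ^ 2) ≤
      (1 + 2 * gradientBound κ R T M + 2 * κ) * (2 * (M * (gradientBound κ R T M + 1)) * R) :=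
  h.energy_le hM0 hκ (h.sq_dx_u_le hκ hM0 (h.abs_F_le hv0 hvT) h0 h1 hF2) h0 h1 hF1

end LogSolution

lemma eq_on_strip_of_eq_interior {T : ℝ} (hT : 0 < T) {φ ψ : ℝ × ℝ → ℝ}
    (hφ : ContinuousOn φ (strip T)) (hψ : ContinuousOn ψ (strip T))
    (he : ∀ x t, t ∈ Ioo 0 T → φ (x, t) = ψ (x, t)) (x t : ℝ) (ht : t ∈ Icc 0 T) :
    φ (x, t) = ψ (x, t) := by
  have h1 : ContinuousOn (fun s => φ (x, s)) (Icc 0 T) := hφ.comp (by fun_prop) fun _ hs => hs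
  have h2 : ContinuousOn (fun s => ψ (x, s)) (Icc 0 T) := hψ.comp (by fun_prop) fun _ hs => hs
  have h3 : EqOn (fun s => φ (x, s)) (fun s => ψ (x, s)) (Ioo 0 T) := he x
  exact h3.of_subset_closure h1 h2 Ioo_subset_Icc_self (closure_Ioo hT.ne).ge ht

lemma bddAbove_range_slice {T R : ℝ} (hR : 0 < R) {φ : ℝ × ℝ → ℝ}
    (hφ : ContinuousOn φ (strip T)) {t : ℝ} (ht : t ∈ Icc 0 T)
    (hper : ∀ x, φ (x + R, t) = φ (x, t)) : BddAbove (range fun x => φ (x, t)) := by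
  obtain ⟨y, hy⟩ := exists_max_slice_of_periodic hR hφ ht hper
  exact ⟨φ (y, t), by rintro _ ⟨x, rfl⟩; exact hy x⟩

/-- Passage to the logarithmic formulation. The equations are only needed in the interior. -/
lemma logSolution_of_interior {R T : ℝ} {f : ℝ → ℝ} {u m : ℝ → ℝ → ℝ} (hR : 0 < R) (hT : 0 < T)
    (hf : ContDiffOn ℝ 2 f (Ioi 0)) (hf' : ∀ s ∈ Ioi (0 : ℝ), 0 < deriv f s)
    (hu : SmoothStrip T (fun p => u p.1 p.2)) (hm : SmoothStrip T (fun p => m p.1 p.2))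
    (hup : ∀ x t : ℝ, t ∈ Icc 0 T → u (x + R) t = u x t)
    (hmp : ∀ x t : ℝ, t ∈ Icc 0 T → m (x + R) t = m x t)
    (hpos : ∀ x t : ℝ, t ∈ Icc 0 T → 0 < m x t)
    (hHJ : ∀ x t : ℝ, t ∈ Ioo 0 T → -pdt u x t + (1 / 2) * (pdx u x t) ^ 2 = f (m x t))
    (hC : ∀ x t : ℝ, t ∈ Ioo 0 T → pdt m x t - pdx (fun y s => m y s * pdx u y s) x t = 0) :
    LogSolution R T (fun s => f (Real.exp s)) (fun s => Real.exp s * deriv f (Real.exp s))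
      (fun s => Real.exp s * deriv f (Real.exp s) +
        Real.exp s * (deriv (deriv f) (Real.exp s) * Real.exp s))
      (fun p => u p.1 p.2) (fun p => Real.log (m p.1 p.2)) := by
  have hfd : ∀ s, 0 < s → HasDerivAt f (deriv f s) s := fun s hs =>
    ((hf.differentiableOn (by simp)) s hs |>.differentiableAt (Ioi_mem_nhds hs)).hasDerivAt
  have hf1 : ContDiffOn ℝ 1 (deriv f) (Ioi 0) := hf.deriv_of_isOpen isOpen_Ioi (by norm_num)
  have hfdd : ∀ s, 0 < s → HasDerivAt (deriv f) (deriv (deriv f) s) s := fun s hs =>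
    ((hf1.differentiableOn (by simp)) s hs |>.differentiableAt (Ioi_mem_nhds hs)).hasDerivAt
  have hn : SmoothStrip T (fun p => Real.log (m p.1 p.2)) :=
    ContDiffOn.log hm fun q hq => (hpos q.1 q.2 hq).ne'
  have hp := hu.dx hT
  have hF : ∀ s, HasDerivAt (fun s => f (Real.exp s)) (Real.exp s * deriv f (Real.exp s)) s :=
    fun s => ((hfd _ (Real.exp_pos s)).comp s (Real.hasDerivAt_exp s)).congr_deriv (mul_comm _ _)
  have hpdx : ∀ x t, t ∈ Icc 0 T → pdx u x t = DX T (fun p => u p.1 p.2) (x, t) :=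
    fun x t ht => (hu.hasDerivAt_space ht x).deriv
  have hpdt : ∀ w : ℝ → ℝ → ℝ, SmoothStrip T (fun p => w p.1 p.2) → ∀ x t, t ∈ Ioo 0 T →
      pdt w x t = DT T (fun p => w p.1 p.2) (x, t) := fun w hw x t ht =>
    ((hw.hasDerivWithinAt_time (Ioo_subset_Icc_self ht) x).hasDerivAt
      (Icc_mem_nhds ht.1 ht.2)).deriv
  refine ⟨hT, hR, hu, hn, hF, ?_, ?_, hup, ?_, ?_, ?_⟩
  · intro s
    exact ((Real.hasDerivAt_exp s).mul
      ((hfdd _ (Real.exp_pos s)).comp s (Real.hasDerivAt_exp s)))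
  · intro s
    exact mul_pos (Real.exp_pos s) (hf' _ (Real.exp_pos s))
  · intro x t ht
    simp only [hmp x t ht]
  · have hcF : Continuous (fun s => f (Real.exp s)) :=
      continuous_iff_continuousAt.2 fun s => (hF s).continuousAt
    refine eq_on_strip_of_eq_interior hT (ψ := fun q => DX T (fun p => u p.1 p.2) q ^ 2 / 2
      - f (Real.exp (Real.log (m q.1 q.2)))) (hu.dt hT).continuousOn
      (((hp.continuousOn.pow 2).div_const 2).sub (hcF.comp_continuousOn hn.continuousOn)) ?_
    intro x t ht
    have hI := Ioo_subset_Icc_self ht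
    have := hHJ x t ht
    rw [hpdt u hu x t ht, hpdx x t hI] at this
    simp only [Real.exp_log (hpos x t hI)]
    linarith
  · refine eq_on_strip_of_eq_interior hT (ψ := fun q => DX T (DX T (fun p => u p.1 p.2)) q
      + DX T (fun p => u p.1 p.2) q * DX T (fun p => Real.log (m p.1 p.2)) q)
      (hn.dt hT).continuousOn
      ((hp.dx hT).continuousOn.add (hp.continuousOn.mul (hn.dx hT).continuousOn)) ?_
    intro x t ht
    have hI := Ioo_subset_Icc_self ht
    have hmne := (hpos x t hI).ne'
    have e1 := hn.dx_eq hI (x := x) (fun _ => rfl) ((hm.hasDerivAt_space hI x).log hmne)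
    have e2 := hn.dt_eq hT hI (x := x) (fun _ _ => rfl)
      ((hm.hasDerivWithinAt_time hI x).log hmne)
    have e3 : pdx (fun y s => m y s * pdx u y s) x t =
        DX T (fun p => m p.1 p.2) (x, t) * DX T (fun p => u p.1 p.2) (x, t)
          + m x t * DX T (DX T (fun p => u p.1 p.2)) (x, t) := by
      have h1 := ((hm.hasDerivAt_space hI x).mul (hp.hasDerivAt_space hI x)).deriv
      rw [← h1, pdx]
      congr 1
      funext y
      simp [hpdx y t hI]
    have e4 := hC x t ht
    rw [e3, hpdt m hm x t ht] at e4
    rw [e1, e2]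
    field_simp
    linarith


/-- Energy estimate for the planning problem: writing `v = f ∘ m`, one has
`∫₀ᵀ ∫₀ᴿ (v_x² + v_t²) dx dt ≤ C` with `C` depending only on `κ₀, R, T, 1/T, M`. -/
theorem stmt7
    (κ₀ R T M : ℝ) (hκ : 0 < κ₀) (hR : 1 ≤ R) (hT : 0 < T) (hM : 0 < M) :
    ∃ C : ℝ, 0 < C ∧
      ∀ (f : ℝ → ℝ) (u m : ℝ → ℝ → ℝ),
        ContDiffOn ℝ 2 f (Ioi 0) →
        (∀ s ∈ Ioi (0:ℝ), 0 < deriv f s) →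
        ContDiffOn ℝ (⊤ : ℕ∞) (fun p : ℝ × ℝ => u p.1 p.2) {p : ℝ × ℝ | p.2 ∈ Icc 0 T} →
        ContDiffOn ℝ (⊤ : ℕ∞) (fun p : ℝ × ℝ => m p.1 p.2) {p : ℝ × ℝ | p.2 ∈ Icc 0 T} →
        (∀ x t : ℝ, t ∈ Icc 0 T → u (x + R) t = u x t) →
        (∀ x t : ℝ, t ∈ Icc 0 T → m (x + R) t = m x t) →
        (∀ x t : ℝ, t ∈ Icc 0 T → 0 < m x t) →
        (∀ x t : ℝ, t ∈ Icc 0 T →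
          -pdt u x t + (1/2) * (pdx u x t)^2 = f (m x t)) →
        (∀ x t : ℝ, t ∈ Icc 0 T →
          pdt m x t - pdx (fun y s => m y s * pdx u y s) x t = 0) →
        (∀ s : ℝ, 0 < s → s ≤ 2 * max (⨆ x : ℝ, m x 0) (⨆ x : ℝ, m x T) →
          s * deriv f s ≤ κ₀ ∧ s * |deriv (deriv f) s| / deriv f s ≤ κ₀) →
        ((⨆ x : ℝ, |f (m x 0)|) + (⨆ x : ℝ, |deriv (fun y => f (m y 0)) x|) ≤ M) →
        ((⨆ x : ℝ, |f (m x T)|) + (⨆ x : ℝ, |deriv (fun y => f (m y T)) x|) ≤ M) →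
        (∫ t in (0:ℝ)..T, ∫ x in (0:ℝ)..R,
          ((pdx (fun y s => f (m y s)) x t)^2 + (pdt (fun y s => f (m y s)) x t)^2)) ≤ C := by
  set K := (1 + 2 * gradientBound κ₀ R T M + 2 * κ₀) *
    (2 * (M * (gradientBound κ₀ R T M + 1)) * R) with hK
  refine ⟨|K| + 1, by positivity, ?_⟩
  intro f u m hf hf' hu hm hup hmp hpos hHJ hC hκs hM0 hM1
  have hR0 : 0 < R := by linarith
  have h := logSolution_of_interior hR0 hT hf hf' hu hm hup hmp hpos
    (fun x t ht => hHJ x t (Ioo_subset_Icc_self ht)) (fun x t ht => hC x t (Ioo_subset_Icc_self ht))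
  set N : ℝ × ℝ → ℝ := fun p => Real.log (m p.1 p.2) with hN
  set V : ℝ × ℝ → ℝ := fun q => f (Real.exp (N q)) with hV
  have h0T : (0 : ℝ) ∈ Icc 0 T := ⟨le_rfl, hT.le⟩
  have hTT : T ∈ Icc 0 T := ⟨hT.le, le_rfl⟩
  have hVs : SmoothStrip T V := h.smooth_F
  have hVm : ∀ x t, t ∈ Icc 0 T → V (x, t) = f (m x t) := fun x t ht => by
    simp only [hV, hN, Real.exp_log (hpos x t ht)]
  have hVper : ∀ x t, t ∈ Icc 0 T → V (x + R, t) = V (x, t) := fun x t ht => by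
    simp only [hV, hN, hmp x t ht]
  have hVx : ∀ x t, t ∈ Icc 0 T → deriv (fun y => f (m y t)) x = DX T V (x, t) := by
    intro x t ht
    rw [← (hVs.hasDerivAt_space ht x).deriv]
    congr 1
    funext y
    exact (hVm y t ht).symm
  have hVt : ∀ x t, t ∈ Ioo 0 T → deriv (fun s => f (m x s)) t = DT T V (x, t) := by
    intro x t ht
    have hd := (hVs.hasDerivWithinAt_time (Ioo_subset_Icc_self ht) x).hasDerivAt
      (Icc_mem_nhds ht.1 ht.2)
    rw [← hd.deriv]
    refine Filter.EventuallyEq.deriv_eq ?_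
    filter_upwards [Icc_mem_nhds ht.1 ht.2] with s hs
    exact (hVm x s hs).symm
  have hdata : ∀ t ∈ Icc 0 T,
      (⨆ x : ℝ, |f (m x t)|) + (⨆ x : ℝ, |deriv (fun y => f (m y t)) x|) ≤ M →
      (∀ x, |V (x, t)| ≤ M) ∧ ∀ x, |DX T V (x, t)| ≤ M := by
    intro t ht hle
    have e1 : (fun x => |f (m x t)|) = fun x => |V (x, t)| := by
      funext x; rw [hVm x t ht]
    have e2 : (fun x => |deriv (fun y => f (m y t)) x|) = fun x => |DX T V (x, t)| := by
      funext x; rw [hVx x t ht]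
    have b1 : BddAbove (range fun x => |V (x, t)|) :=
      bddAbove_range_slice hR0 (φ := fun q => |V q|) hVs.continuousOn.abs ht
        (fun x => by simp only [hVper x t ht])
    have b2 : BddAbove (range fun x => |DX T V (x, t)|) :=
      bddAbove_range_slice hR0 (φ := fun q => |DX T V q|) (hVs.dx hT).continuousOn.abs ht
        (fun x => by simp only [hVs.periodic_dx hVper x t ht])
    rw [e1, e2] at hle
    have n1 : 0 ≤ ⨆ x : ℝ, |V (x, t)| := Real.iSup_nonneg fun x => abs_nonneg _
    have n2 : 0 ≤ ⨆ x : ℝ, |DX T V (x, t)| := Real.iSup_nonneg fun x => abs_nonneg _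
    exact ⟨fun x => by linarith [le_ciSup b1 x], fun x => by linarith [le_ciSup b2 x]⟩
  obtain ⟨hv0, hd0⟩ := hdata 0 h0T hM0
  obtain ⟨hv1, hd1⟩ := hdata T hTT hM1
  have hmle : ∀ x t, t ∈ Icc 0 T → m x t ≤ 2 * max (⨆ x : ℝ, m x 0) (⨆ x : ℝ, m x T) := by
    intro x t ht
    obtain ⟨y, s, hs, hle⟩ := h.exists_boundary_extremum (σ := 1) (by norm_num) x t ht
    have hsI : s ∈ Icc 0 T := by rcases hs with rfl | rfl <;> assumption
    simp only [one_mul] at hle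
    have h1 : m x t ≤ m y s :=
      (Real.log_le_log_iff (hpos x t ht) (hpos y s hsI)).1 hle
    have b : ∀ r ∈ Icc 0 T, BddAbove (range fun x => m x r) := fun r hr =>
      bddAbove_range_slice hR0 (φ := fun q => m q.1 q.2) (ContDiffOn.continuousOn hm) hr
        (fun x => hmp x r hr)
    have h2 : m y s ≤ max (⨆ x : ℝ, m x 0) (⨆ x : ℝ, m x T) := by
      rcases hs with rfl | rfl
      · exact (le_ciSup (b 0 h0T) y).trans (le_max_left _ _)
      · exact (le_ciSup (b _ hTT) y).trans (le_max_right _ _)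
    linarith [hpos x t ht]
  have hest := h.energy_estimate hM hκ hv0 hv1 hd0 hd1
    (fun x t ht => by
      simp only [hN, Real.exp_log (hpos x t ht)]
      exact (hκs _ (hpos x t ht) (hmle x t ht)).1)
    (fun x t ht => by
      simp only [hN, Real.exp_log (hpos x t ht)]
      have hs := hpos x t ht
      have hfp := hf' _ hs
      have hk := (div_le_iff₀ hfp).1 (hκs _ hs (hmle x t ht)).2
      generalize m x t = s at *
      calc |s * deriv f s + s * (deriv (deriv f) s * s)|
          ≤ |s * deriv f s| + |s * (deriv (deriv f) s * s)| := abs_add_le _ _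
        _ = s * deriv f s + s * (s * |deriv (deriv f) s|) := by
          rw [abs_of_pos (mul_pos hs hfp), abs_mul, abs_mul, abs_of_pos hs]; ring
        _ ≤ s * deriv f s + s * (κ₀ * deriv f s) := by gcongr
        _ = (1 + κ₀) * (s * deriv f s) := by ring)
  refine le_trans (le_of_eq ?_) (hest.trans ((le_abs_self K).trans (by linarith)))
  refine intervalIntegral.integral_congr_Ioo_of_le hT.le fun t ht => ?_
  refine intervalIntegral.integral_congr fun x _ => ?_
  simp only [pdx, pdt]
  rw [hVx x t (Ioo_subset_Icc_self ht), hVt x t ht]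
end

section
/- Let z₀ ∈ ℝ², let 0 < r₁ ≤ r₂, and let v : ℝ² → ℝ be C¹ on the closed ball B̄_{r₂}(z₀). Assume that v satisfies the maximum and minimum principles on the concentric balls: for every r ∈ [r₁, r₂], sup over B̄_r(z₀) of v equals sup over the circle ∂B_r(z₀) of v, and inf over B̄_r(z₀) of v equals inf over ∂B_r(z₀) of v. Then ( osc_{B̄_{r₁}(z₀)} v )² · log(r₂/r₁) ≤ π · ∫_{B̄_{r₂}(z₀)} |∇v|², where osc_A v = sup_A v − inf_A v and the integral is with respect to 2-dimensional Lebesgue measure. -/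
open Real Metric MeasureTheory

/-- One-dimensional Cauchy–Schwarz estimate for an increment. -/
lemma sub_sq_le_mul_integral_deriv_sq {g g' : ℝ → ℝ} (hg : ∀ x, HasDerivAt g (g' x) x)
    (hg' : Continuous g') {a b : ℝ} (hab : a ≤ b) :
    (g b - g a) ^ 2 ≤ (b - a) * ∫ x in a..b, g' x ^ 2 := by
  rcases hab.eq_or_lt with rfl | hlt
  · simp
  have hFTC : ∫ x in a..b, g' x = g b - g a :=
    intervalIntegral.integral_eq_sub_of_hasDerivAt (fun x _ => hg x) (hg'.intervalIntegrable _ _)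
  have hba : 0 < b - a := sub_pos.2 hlt
  set c := (g b - g a) / (b - a) with hc
  have hcM : c * (b - a) = g b - g a := div_mul_cancel₀ _ hba.ne'
  have hexp : ∫ x in a..b, (g' x - c) ^ 2
      = (∫ x in a..b, g' x ^ 2) - 2 * c * (g b - g a) + c ^ 2 * (b - a) := by
    have h1 : ∀ x, (g' x - c) ^ 2 = (g' x ^ 2 - 2 * c * g' x) + c ^ 2 := fun x => by ring
    simp_rw [h1]
    rw [intervalIntegral.integral_add (Continuous.intervalIntegrable (by fun_prop) _ _)
        (Continuous.intervalIntegrable (by fun_prop) _ _),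
      intervalIntegral.integral_sub (Continuous.intervalIntegrable (by fun_prop) _ _)
        (Continuous.intervalIntegrable (by fun_prop) _ _),
      intervalIntegral.integral_const_mul, hFTC, intervalIntegral.integral_const, smul_eq_mul]
    ring
  have hnn : 0 ≤ ∫ x in a..b, (g' x - c) ^ 2 :=
    intervalIntegral.integral_nonneg hab fun x _ => sq_nonneg _
  rw [hexp, ← hcM] at hnn
  rw [← hcM]
  nlinarith [mul_nonneg hba.le hnn]

/-- The increments of a `2π`-periodic function are controlled by the `L²` norm of its derivative,
since any two points of the circle are joined by an arc of length at most `π`. -/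
lemma Function.Periodic.sub_sq_le_pi_mul_integral {g g' h : ℝ → ℝ}
    (hper : Function.Periodic g (2 * π)) (hg : ∀ x, HasDerivAt g (g' x) x) (hg' : Continuous g')
    (hhper : Function.Periodic h (2 * π)) (hh : Continuous h) (hle : ∀ x, g' x ^ 2 ≤ h x)
    (s t : ℝ) : (g s - g t) ^ 2 ≤ π * ∫ x in -π..π, h x := by
  have hpos : ∀ x, 0 ≤ h x := fun x => (sq_nonneg _).trans (hle x)
  have key : ∀ a b, a ≤ b → b ≤ a + π → (g b - g a) ^ 2 ≤ π * ∫ x in -π..π, h x := by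
    intro a b hab hba
    have hI : ∫ x in a..b, g' x ^ 2 ≤ ∫ x in -π..π, h x := by
      calc ∫ x in a..b, g' x ^ 2 ≤ ∫ x in a..b, h x :=
            intervalIntegral.integral_mono_on hab
              ((hg'.pow 2).intervalIntegrable _ _) (hh.intervalIntegrable _ _) fun x _ => hle x
        _ ≤ ∫ x in a..a + 2 * π, h x :=
            intervalIntegral.integral_mono_interval le_rfl hab (by linarith [pi_pos])
              (Filter.Eventually.of_forall hpos) (hh.intervalIntegrable _ _)
        _ = ∫ x in -π..-π + 2 * π, h x := hhper.intervalIntegral_add_eq _ _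
        _ = ∫ x in -π..π, h x := by congr 1; ring
    refine (sub_sq_le_mul_integral_deriv_sq hg hg' hab).trans ?_
    exact mul_le_mul (by linarith) hI
      (intervalIntegral.integral_nonneg hab fun x _ => sq_nonneg _) pi_pos.le
  obtain ⟨t', ht', hgt⟩ := hper.exists_mem_Ico two_pi_pos t (s - π)
  rw [hgt]
  rcases le_total t' s with hts | hst
  · exact key t' s hts (by linarith [ht'.1])
  · rw [← neg_sub, neg_sq]
    exact key s t' hst (by linarith [ht'.2])

lemma polarCoord_symm_eq_circleMap (p : ℝ × ℝ) :
    Complex.polarCoord.symm p = circleMap 0 p.1 p.2 := by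
  rw [Complex.polarCoord_symm_apply, circleMap, zero_add, Complex.exp_mul_I]
  push_cast
  rfl

/-- Polar coordinates on an annulus, for a nonnegative function on a disc. -/
lemma integral_annulus_le {G : ℂ → ℝ} {r₁ r₂ : ℝ} (hr₁ : 0 < r₁)
    (hG : ContinuousOn G (closedBall 0 r₂)) (hG0 : ∀ z, 0 ≤ G z) :
    IntegrableOn (fun r => ∫ θ in -π..π, r * G (circleMap 0 r θ)) (Set.Ioc r₁ r₂) ∧
    ∫ r in Set.Ioc r₁ r₂, ∫ θ in -π..π, r * G (circleMap 0 r θ)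
      ≤ ∫ z in closedBall 0 r₂, G z := by
  set F : ℝ × ℝ → ℝ := fun p => p.1 * G (circleMap 0 p.1 p.2) with hF
  have hcont : ContinuousOn F (Set.Icc 0 r₂ ×ˢ Set.Icc (-π) π) := by
    refine continuousOn_fst.mul (hG.comp (Continuous.continuousOn ?_) ?_)
    · unfold circleMap
      fun_prop
    · rintro p ⟨hp, -⟩
      simpa [abs_of_nonneg hp.1] using hp.2
  have hint : IntegrableOn F (Set.Icc 0 r₂ ×ˢ Set.Icc (-π) π) :=
    hcont.integrableOn_compact (isCompact_Icc.prod isCompact_Icc)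
  have hint' : IntegrableOn F (Set.Ioc 0 r₂ ×ˢ Set.Ioo (-π) π) :=
    hint.mono_set (Set.prod_mono Set.Ioc_subset_Icc_self Set.Ioo_subset_Icc_self)
  have hsub : Set.Ioc r₁ r₂ ×ˢ Set.Ioo (-π) π ⊆ Set.Ioc 0 r₂ ×ˢ Set.Ioo (-π) π :=
    Set.prod_mono (Set.Ioc_subset_Ioc_left hr₁.le) le_rfl
  have hintA : IntegrableOn F (Set.Ioc r₁ r₂ ×ˢ Set.Ioo (-π) π) := hint'.mono_set hsub
  have hinner : ∀ r : ℝ, ∫ θ in -π..π, r * G (circleMap 0 r θ)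
      = ∫ θ in Set.Ioo (-π) π, F (r, θ) := fun r => by
    rw [intervalIntegral.integral_of_le (by linarith [pi_pos]), integral_Ioc_eq_integral_Ioo]
  simp_rw [hinner]
  have hpolar : ∫ z in closedBall 0 r₂, G z = ∫ p in Set.Ioc 0 r₂ ×ˢ Set.Ioo (-π) π, F p := by
    rw [← integral_indicator measurableSet_closedBall, ← Complex.integral_comp_polarCoord_symm,
      polarCoord_target]
    have hset : Set.Ioc 0 r₂ ×ˢ Set.Ioo (-π) π
        = (Set.Ioi 0 ×ˢ Set.Ioo (-π) π) ∩ {p : ℝ × ℝ | p.1 ≤ r₂} := by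
      ext p
      simp only [Set.mem_prod, Set.mem_Ioc, Set.mem_Ioi, Set.mem_inter_iff, Set.mem_ofPred_eq]
      tauto
    rw [hset, ← setIntegral_indicator (measurableSet_le measurable_fst measurable_const)]
    refine setIntegral_congr_fun (measurableSet_Ioi.prod measurableSet_Ioo) ?_
    rintro p ⟨hp, -⟩
    have hp' : 0 < p.1 := hp
    simp only [polarCoord_symm_eq_circleMap, smul_eq_mul]
    by_cases hpr : p.1 ≤ r₂
    · rw [Set.indicator_of_mem (by simpa [abs_of_pos hp'] using hpr),
        Set.indicator_of_mem (show p ∈ {p : ℝ × ℝ | p.1 ≤ r₂} from hpr)]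
    · rw [Set.indicator_of_notMem (by simpa [abs_of_pos hp'] using hpr),
        Set.indicator_of_notMem (show p ∉ {p : ℝ × ℝ | p.1 ≤ r₂} from hpr), mul_zero]
  refine ⟨?_, ?_⟩
  · have h := hintA
    rw [IntegrableOn, Measure.volume_eq_prod, ← Measure.prod_restrict] at h
    exact h.integral_prod_left
  · rw [hpolar, ← setIntegral_prod F (by rwa [← Measure.volume_eq_prod]),
      ← Measure.volume_eq_prod]
    refine setIntegral_mono_set hint' ?_ (LE.le.eventuallyLE hsub)
    filter_upwards [ae_restrict_mem (measurableSet_Ioc.prod measurableSet_Ioo)] with p hp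
    exact mul_nonneg hp.1.1.le (hG0 _)

/-- The logarithmic modulus of continuity, for functions on the complex plane. -/
lemma osc_sq_mul_log_le_complex {r₁ r₂ : ℝ} (hr₁ : 0 < r₁) (hr : r₁ ≤ r₂) {w : ℂ → ℝ}
    (hw : ContDiffOn ℝ 1 w (closedBall 0 r₂))
    (hmax : ∀ r ∈ Set.Icc r₁ r₂, sSup (w '' closedBall 0 r) = sSup (w '' sphere 0 r))
    (hmin : ∀ r ∈ Set.Icc r₁ r₂, sInf (w '' closedBall 0 r) = sInf (w '' sphere 0 r)) :
    (sSup (w '' closedBall 0 r₁) - sInf (w '' closedBall 0 r₁)) ^ 2 * Real.log (r₂ / r₁)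
      ≤ π * ∫ z in closedBall 0 r₂, ‖fderiv ℝ w z‖ ^ 2 := by
  have hr₂ : 0 < r₂ := hr₁.trans_le hr
  set D := fderivWithin ℝ w (closedBall 0 r₂) with hD
  have hDc : ContinuousOn D (closedBall 0 r₂) :=
    hw.continuousOn_fderivWithin (uniqueDiffOn_convex (convex_closedBall _ _)
      ⟨0, ball_subset_interior_closedBall (mem_ball_self hr₂)⟩) le_rfl
  have hnhds : ∀ z ∈ ball (0 : ℂ) r₂, closedBall (0 : ℂ) r₂ ∈ nhds z := fun z hz =>
    Filter.mem_of_superset (isOpen_ball.mem_nhds hz) ball_subset_closedBall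
  have hDint : ∫ z in closedBall 0 r₂, ‖fderiv ℝ w z‖ ^ 2 = ∫ z in closedBall 0 r₂, ‖D z‖ ^ 2 := by
    refine integral_congr_ae ?_
    have hs : ∀ᵐ z : ℂ, z ∉ sphere (0 : ℂ) r₂ :=
      measure_eq_zero_iff_ae_notMem.1 (Measure.addHaar_sphere volume 0 r₂)
    filter_upwards [ae_restrict_of_ae hs, ae_restrict_mem measurableSet_closedBall] with z hz hz'
    have hzb : z ∈ ball (0 : ℂ) r₂ := lt_of_le_of_ne hz' hz
    rw [hD, fderivWithin_of_mem_nhds (hnhds z hzb)]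
  set O := sSup (w '' closedBall 0 r₁) - sInf (w '' closedBall 0 r₁) with hO
  have hO0 : 0 ≤ O := by
    have hK : IsCompact (w '' closedBall 0 r₁) := (isCompact_closedBall _ _).image_of_continuousOn
      (hw.continuousOn.mono (closedBall_subset_closedBall hr))
    exact sub_nonneg.2 (Real.sInf_le_sSup _ hK.bddBelow hK.bddAbove)
  have hcircle : ∀ r ∈ Set.Ioo r₁ r₂,
      O ^ 2 * r⁻¹ ≤ π * ∫ θ in -π..π, r * ‖D (circleMap 0 r θ)‖ ^ 2 := by
    rintro r ⟨hr1, hr2⟩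
    have hr0 : 0 < r := hr₁.trans hr1
    have hcball : ∀ θ, circleMap 0 r θ ∈ ball (0 : ℂ) r₂ := fun θ => by
      simpa [abs_of_pos hr0] using hr2
    have hsph : IsCompact (sphere (0 : ℂ) r) := isCompact_sphere _ _
    have hsne : (sphere (0 : ℂ) r).Nonempty := NormedSpace.sphere_nonempty.2 hr0.le
    have hwc : ContinuousOn w (sphere 0 r) :=
      hw.continuousOn.mono (sphere_subset_closedBall.trans (closedBall_subset_closedBall hr2.le))
    obtain ⟨x, hx, hxs⟩ := hsph.exists_sSup_image_eq hsne hwc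
    obtain ⟨y, hy, hys⟩ := hsph.exists_sInf_image_eq hsne hwc
    rw [← abs_of_pos hr0, ← range_circleMap] at hx hy
    obtain ⟨s, rfl⟩ := hx
    obtain ⟨t, rfl⟩ := hy
    have hOr : O ≤ w (circleMap 0 r s) - w (circleMap 0 r t) := by
      have hK : IsCompact (w '' closedBall 0 r) := (isCompact_closedBall _ _).image_of_continuousOn
        (hw.continuousOn.mono (closedBall_subset_closedBall hr2.le))
      have hsub : w '' closedBall 0 r₁ ⊆ w '' closedBall 0 r :=
        Set.image_mono (closedBall_subset_closedBall hr1.le)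
      have hne : (w '' closedBall 0 r₁).Nonempty := (nonempty_closedBall.2 hr₁.le).image _
      rw [← hxs, ← hys, ← hmax r ⟨hr1.le, hr2.le⟩, ← hmin r ⟨hr1.le, hr2.le⟩]
      exact sub_le_sub (csSup_le_csSup hK.bddAbove hne hsub) (csInf_le_csInf hK.bddBelow hne hsub)
    have hDcirc : Continuous fun θ => D (circleMap 0 r θ) :=
      hDc.comp_continuous (continuous_circleMap 0 r) fun θ => ball_subset_closedBall (hcball θ)
    have hderiv : ∀ θ, HasDerivAt (fun θ => w (circleMap 0 r θ))
        (D (circleMap 0 r θ) (circleMap 0 r θ * Complex.I)) θ := fun θ => by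
      have h1 := ((hw.differentiableOn one_ne_zero) _
        (ball_subset_closedBall (hcball θ))).hasFDerivWithinAt.hasFDerivAt (hnhds _ (hcball θ))
      exact h1.comp_hasDerivAt θ (hasDerivAt_circleMap 0 r θ)
    have hbound := Function.Periodic.sub_sq_le_pi_mul_integral
      (g := fun θ => w (circleMap 0 r θ)) (h := fun θ => r ^ 2 * ‖D (circleMap 0 r θ)‖ ^ 2)
      (fun θ => by simp only [periodic_circleMap 0 r θ]) hderiv
      (hDcirc.clm_apply ((continuous_circleMap 0 r).mul continuous_const))
      (fun θ => by simp only [periodic_circleMap 0 r θ]) (continuous_const.mul (hDcirc.norm.pow 2))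
      (fun θ => by
        have h1 := (D (circleMap 0 r θ)).le_opNorm (circleMap 0 r θ * Complex.I)
        have h2 : ‖circleMap 0 r θ * Complex.I‖ = r := by simp [abs_of_pos hr0]
        rw [h2, Real.norm_eq_abs] at h1
        rw [← sq_abs, ← mul_pow, mul_comm r]
        exact pow_le_pow_left₀ (abs_nonneg _) h1 2) s t
    rw [intervalIntegral.integral_const_mul] at hbound ⊢
    have hO2 := (pow_le_pow_left₀ hO0 hOr 2).trans hbound
    rw [← div_eq_mul_inv, div_le_iff₀ hr0]
    calc O ^ 2 ≤ _ := hO2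
      _ = _ := by ring
  obtain ⟨hint, hle⟩ := integral_annulus_le hr₁ (hDc.norm.pow 2) (fun z => sq_nonneg ‖D z‖)
  rw [hDint, ← integral_inv_of_pos hr₁ hr₂, ← intervalIntegral.integral_const_mul,
    intervalIntegral.integral_of_le hr]
  refine le_trans ?_ (mul_le_mul_of_nonneg_left hle pi_pos.le)
  rw [← integral_const_mul, integral_Ioc_eq_integral_Ioo, integral_Ioc_eq_integral_Ioo]
  refine setIntegral_mono_on ?_ ((hint.mono_set Set.Ioo_subset_Ioc_self).const_mul π)
    measurableSet_Ioo hcircle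
  refine IntegrableOn.mono_set (t := Set.Icc r₁ r₂) ?_ Set.Ioo_subset_Icc_self
  exact (continuousOn_const.mul (continuousOn_id.inv₀ fun x hx =>
    (hr₁.trans_le hx.1).ne')).integrableOn_Icc

/-- Lebesgue's logarithmic modulus of continuity: if `v` is C¹ on the closed Euclidean ball
`B̄_{r₂}(z₀) ⊆ ℝ²` and satisfies the maximum and minimum principles on all concentric balls
of radius `r ∈ [r₁, r₂]`, then
`(osc_{B̄_{r₁}} v)² log(r₂/r₁) ≤ π ∫_{B̄_{r₂}} |∇v|²`. -/
theorem stmt8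
    (z₀ : EuclideanSpace ℝ (Fin 2)) (r₁ r₂ : ℝ) (hr₁ : 0 < r₁) (hr : r₁ ≤ r₂)
    (v : EuclideanSpace ℝ (Fin 2) → ℝ)
    (hv : ContDiffOn ℝ 1 v (closedBall z₀ r₂))
    (hmax : ∀ r ∈ Set.Icc r₁ r₂,
      sSup (v '' closedBall z₀ r) = sSup (v '' sphere z₀ r))
    (hmin : ∀ r ∈ Set.Icc r₁ r₂,
      sInf (v '' closedBall z₀ r) = sInf (v '' sphere z₀ r)) :
    (sSup (v '' closedBall z₀ r₁) - sInf (v '' closedBall z₀ r₁))^2 * Real.log (r₂ / r₁)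
      ≤ π * ∫ z in closedBall z₀ r₂, ‖fderiv ℝ v z‖^2 := by
  let e : ℂ ≃ₗᵢ[ℝ] EuclideanSpace ℝ (Fin 2) := Complex.orthonormalBasisOneI.repr
  let φ : ℂ ≃ᵢ EuclideanSpace ℝ (Fin 2) := e.toIsometryEquiv.trans (IsometryEquiv.addLeft z₀)
  have hφ : ∀ z, φ z = z₀ + e z := fun z => rfl
  have hφ0 : φ 0 = z₀ := by simp [hφ]
  have hball : ∀ r, v '' closedBall z₀ r = (v ∘ φ) '' closedBall 0 r := fun r => by
    rw [Set.image_comp, φ.image_closedBall, hφ0]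
  have hsphere : ∀ r, v '' sphere z₀ r = (v ∘ φ) '' sphere 0 r := fun r => by
    rw [Set.image_comp, φ.image_sphere, hφ0]
  have hpre : φ ⁻¹' closedBall z₀ r₂ = closedBall 0 r₂ := by
    rw [← hφ0, φ.preimage_closedBall, φ.symm_apply_apply]
  have hfderiv : ∀ z, ‖fderiv ℝ (v ∘ φ) z‖ = ‖fderiv ℝ v (φ z)‖ := fun z => by
    have h1 : v ∘ φ = (fun x => v (z₀ + x)) ∘ e.toContinuousLinearEquiv := rfl
    rw [h1, e.toContinuousLinearEquiv.comp_right_fderiv (f := fun x => v (z₀ + x)) (x := z),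
      fderiv_comp_add_left]
    exact ContinuousLinearMap.opNorm_comp_linearIsometryEquiv _ e
  have hmp : MeasurePreserving φ volume volume :=
    (measurePreserving_add_left volume z₀).comp e.measurePreserving
  have hint : ∫ z in closedBall z₀ r₂, ‖fderiv ℝ v z‖ ^ 2
      = ∫ z in closedBall 0 r₂, ‖fderiv ℝ (v ∘ φ) z‖ ^ 2 := by
    rw [← hmp.setIntegral_preimage_emb φ.toHomeomorph.measurableEmbedding, hpre]
    simp_rw [hfderiv]
  have hw : ContDiffOn ℝ 1 (v ∘ φ) (closedBall 0 r₂) :=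
    hv.comp (contDiff_const.add e.contDiff).contDiffOn hpre.ge
  simp_rw [hball, hsphere] at hmax hmin
  rw [hint, hball]
  exact osc_sq_mul_log_le_complex hr₁ hr hw hmax hmin
end

section
/- Let T > 0, let f : (0,∞) → ℝ be C¹, and let (u,m) be a classical solution of the 1D MFG system with coupling f on ℝ × (0,T). Let γ : ℝ × (0,T) → ℝ be such that for every x the map t ↦ γ(x,t) is differentiable with ∂_t γ(x,t) = −u_x(γ(x,t), t). Then for every (x,t) ∈ ℝ × (0,T) the map t ↦ γ(x,t) is twice differentiable and satisfies the Euler equation ∂_t∂_t γ(x,t) = f'( m(γ(x,t), t) ) · m_x(γ(x,t), t). -/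
open Set

/-- The space derivative of a two-variable function as a Fréchet derivative along `(1, 0)`. -/
theorem hasDerivAt_fst_of_differentiableAt {g : ℝ → ℝ → ℝ} {x t : ℝ}
    (h : DifferentiableAt ℝ (fun p : ℝ × ℝ => g p.1 p.2) (x, t)) :
    HasDerivAt (fun y => g y t) (fderiv ℝ (fun p : ℝ × ℝ => g p.1 p.2) (x, t) (1, 0)) x :=
  HasFDerivAt.comp_hasDerivAt (f := fun y => (y, t)) x h.hasFDerivAt
    ((hasDerivAt_id x).prodMk (hasDerivAt_const x t))

/-- The time derivative of a two-variable function as a Fréchet derivative along `(0, 1)`. -/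
theorem hasDerivAt_snd_of_differentiableAt {g : ℝ → ℝ → ℝ} {x t : ℝ}
    (h : DifferentiableAt ℝ (fun p : ℝ × ℝ => g p.1 p.2) (x, t)) :
    HasDerivAt (fun s => g x s) (fderiv ℝ (fun p : ℝ × ℝ => g p.1 p.2) (x, t) (0, 1)) t :=
  HasFDerivAt.comp_hasDerivAt (f := fun s => (x, s)) t h.hasFDerivAt
    ((hasDerivAt_const t x).prodMk (hasDerivAt_id t))

/-- Euler equation along optimal trajectories: if `(u, m)` is a classical solution of the
1D MFG system with C¹ coupling `f` on `ℝ × (0,T)` and `γ` solves `∂ₜγ(x,t) = -u_x(γ(x,t),t)`,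
then `t ↦ γ(x,t)` is twice differentiable and
`∂ₜ∂ₜ γ(x,t) = f'(m(γ(x,t),t)) m_x(γ(x,t),t)`. -/
theorem stmt9
    (T : ℝ) (hT : 0 < T)
    (f : ℝ → ℝ) (hf : ContDiffOn ℝ 1 f (Ioi 0))
    (u m : ℝ → ℝ → ℝ)
    (hu : ContDiffOn ℝ (⊤ : ℕ∞) (fun p : ℝ × ℝ => u p.1 p.2) {p : ℝ × ℝ | p.2 ∈ Ioo 0 T})
    (hm : ContDiffOn ℝ (⊤ : ℕ∞) (fun p : ℝ × ℝ => m p.1 p.2) {p : ℝ × ℝ | p.2 ∈ Ioo 0 T})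
    (hmpos : ∀ x t : ℝ, t ∈ Ioo 0 T → 0 < m x t)
    (hHJ : ∀ x t : ℝ, t ∈ Ioo 0 T →
      -pdt u x t + (1/2) * (pdx u x t)^2 = f (m x t))
    (hCE : ∀ x t : ℝ, t ∈ Ioo 0 T →
      pdt m x t - pdx (fun y s => m y s * pdx u y s) x t = 0)
    (γ : ℝ → ℝ → ℝ)
    (hγ : ∀ x t : ℝ, t ∈ Ioo 0 T →
      HasDerivAt (fun s => γ x s) (-(pdx u (γ x t) t)) t) :
    ∀ x t : ℝ, t ∈ Ioo 0 T →
      DifferentiableAt ℝ (deriv (fun s => γ x s)) t ∧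
      deriv (deriv (fun s => γ x s)) t
        = deriv f (m (γ x t) t) * pdx m (γ x t) t := by
  have hS : IsOpen {p : ℝ × ℝ | p.2 ∈ Ioo 0 T} := isOpen_Ioo.preimage continuous_snd
  set U : ℝ × ℝ → ℝ := fun p => u p.1 p.2
  have hUat : ∀ x t : ℝ, t ∈ Ioo 0 T → ContDiffAt ℝ (⊤ : ℕ∞) U (x, t) := fun x t ht =>
    hu.contDiffAt (hS.mem_nhds ht)
  have hUd : ∀ x t : ℝ, t ∈ Ioo 0 T → DifferentiableAt ℝ U (x, t) := fun x t ht =>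
    (hUat x t ht).differentiableAt (by simp)
  have hx : ∀ x t : ℝ, t ∈ Ioo 0 T → pdx u x t = fderiv ℝ U (x, t) (1, 0) := fun x t ht =>
    (hasDerivAt_fst_of_differentiableAt (hUd x t ht)).deriv
  have ht' : ∀ x t : ℝ, t ∈ Ioo 0 T → pdt u x t = fderiv ℝ U (x, t) (0, 1) := fun x t ht =>
    (hasDerivAt_snd_of_differentiableAt (hUd x t ht)).deriv
  intro x t ht
  have hU2 : ContDiffAt ℝ 2 U (γ x t, t) :=
    (hUat (γ x t) t ht).of_le (WithTop.coe_le_coe.2 le_top)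
  have hD : HasFDerivAt (fderiv ℝ U) (fderiv ℝ (fderiv ℝ U) (γ x t, t)) (γ x t, t) :=
    ((hU2.fderiv_right (m := 1) (by norm_num)).differentiableAt one_ne_zero).hasFDerivAt
  have hsymm : IsSymmSndFDerivAt ℝ U (γ x t, t) :=
    hU2.isSymmSndFDerivAt (by simp)
  set D := fderiv ℝ (fderiv ℝ U) (γ x t, t)
  -- Differentiating the Hamilton–Jacobi equation in space.
  have hline : HasDerivAt (fun y => fderiv ℝ U (y, t)) (D (1, 0)) (γ x t) :=
    hD.comp_hasDerivAt (γ x t) ((hasDerivAt_id _).prodMk (hasDerivAt_const _ t))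
  have hHJx : HasDerivAt
      (fun y => -fderiv ℝ U (y, t) (0, 1) + (1 / 2) * (fderiv ℝ U (y, t) (1, 0)) ^ 2)
      (-D (1, 0) (0, 1) + pdx u (γ x t) t * D (1, 0) (1, 0)) (γ x t) := by
    have h1 := hline.clm_apply (hasDerivAt_const (γ x t) ((0, 1) : ℝ × ℝ))
    have h2 := hline.clm_apply (hasDerivAt_const (γ x t) ((1, 0) : ℝ × ℝ))
    simp only [map_zero, add_zero] at h1 h2
    refine (h1.fun_neg.fun_add ((h2.fun_pow 2).const_mul (1 / 2))).congr_deriv ?_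
    rw [hx _ _ ht]
    ring
  have hmx : HasDerivAt (fun y => m y t) (pdx m (γ x t) t) (γ x t) :=
    (hasDerivAt_fst_of_differentiableAt
      ((hm.contDiffAt (hS.mem_nhds (x := (γ x t, t)) ht)).differentiableAt
        (by simp))).differentiableAt.hasDerivAt
  have hfm : HasDerivAt f (deriv f (m (γ x t) t)) (m (γ x t) t) :=
    ((hf.contDiffAt (isOpen_Ioi.mem_nhds (hmpos _ _ ht))).differentiableAt
      one_ne_zero).hasDerivAt
  have hHJeq : (fun y => -fderiv ℝ U (y, t) (0, 1) + (1 / 2) * (fderiv ℝ U (y, t) (1, 0)) ^ 2)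
      = fun y => f (m y t) := by
    funext y
    rw [← hx y t ht, ← ht' y t ht, hHJ y t ht]
  rw [hHJeq] at hHJx
  have key := hHJx.unique (HasDerivAt.comp (γ x t) hfm hmx)
  -- Differentiating the velocity along the trajectory.
  have hvel : HasDerivAt (fun s => -fderiv ℝ U (γ x s, s) (1, 0))
      (-D (-(pdx u (γ x t) t), 1) (1, 0)) t := by
    have h1 : HasDerivAt (fun s => fderiv ℝ U (γ x s, s)) (D (-(pdx u (γ x t) t), 1)) t :=
      HasFDerivAt.comp_hasDerivAt (f := fun s => (γ x s, s)) t hD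
        ((hγ x t ht).prodMk (hasDerivAt_id t))
    have h2 := h1.clm_apply (hasDerivAt_const t ((1, 0) : ℝ × ℝ))
    simp only [map_zero, add_zero] at h2
    exact h2.neg
  have heq : deriv (fun s => γ x s) =ᶠ[nhds t] fun s => -fderiv ℝ U (γ x s, s) (1, 0) := by
    filter_upwards [isOpen_Ioo.mem_nhds ht] with s hs
    rw [(hγ x s hs).deriv, hx _ _ hs]
  have hγ2 := hvel.congr_of_eventuallyEq heq
  refine ⟨hγ2.differentiableAt, ?_⟩
  have hsplit : ((-(pdx u (γ x t) t), 1) : ℝ × ℝ)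
      = -(pdx u (γ x t) t) • ((1, 0) : ℝ × ℝ) + (0, 1) := by
    ext <;> simp
  have hsw : D (0, 1) (1, 0) = D (1, 0) (0, 1) := hsymm (0, 1) (1, 0)
  rw [hγ2.deriv, ← key, hsplit, map_add, map_smul]
  simp only [add_apply, smul_apply, smul_eq_mul, hsw]
  ring
end

section
/- Let Ω ⊆ ℝ² be open, let f : (0,∞) → ℝ be C¹, and let (u,m) be a classical solution of the 1D MFG system with coupling f on Ω. Let M : Ω → ℝ be C² with ∂_x M = −m and ∂_t M − u_x·∂_x M = 0 on Ω. Then M satisfies the quasilinear elliptic equation −( M_t²/M_x² )·M_{xx} + 2·( M_t/M_x )·M_{xt} − M_{tt} + M_x·f'(−M_x)·M_{xx} = 0 at every point of Ω (note M_x = −m < 0, so all quotients and f'(−M_x) are well defined). -/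
open Set

/-- The horizontal slice of a function differentiable at a point of the plane. -/
theorem hasDerivAt_slice_fst {g : ℝ → ℝ → ℝ} {x t : ℝ}
    (hg : DifferentiableAt ℝ (fun p : ℝ × ℝ => g p.1 p.2) (x, t)) :
    HasDerivAt (fun y => g y t) (fderiv ℝ (fun p : ℝ × ℝ => g p.1 p.2) (x, t) (1, 0)) x :=
  HasFDerivAt.comp_hasDerivAt (f := fun y => (y, t)) x hg.hasFDerivAt
    ((hasDerivAt_id x).prodMk (hasDerivAt_const x t))

/-- The vertical slice of a function differentiable at a point of the plane. -/
theorem hasDerivAt_slice_snd {g : ℝ → ℝ → ℝ} {x t : ℝ}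
    (hg : DifferentiableAt ℝ (fun p : ℝ × ℝ => g p.1 p.2) (x, t)) :
    HasDerivAt (fun s => g x s) (fderiv ℝ (fun p : ℝ × ℝ => g p.1 p.2) (x, t) (0, 1)) t :=
  HasFDerivAt.comp_hasDerivAt (f := fun s => (x, s)) t hg.hasFDerivAt
    ((hasDerivAt_const t x).prodMk (hasDerivAt_id t))

theorem hasDerivAt_pdx {g : ℝ → ℝ → ℝ} {x t : ℝ}
    (hg : DifferentiableAt ℝ (fun p : ℝ × ℝ => g p.1 p.2) (x, t)) :
    HasDerivAt (fun y => g y t) (pdx g x t) x :=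
  (hasDerivAt_slice_fst hg).differentiableAt.hasDerivAt

theorem hasDerivAt_pdt {g : ℝ → ℝ → ℝ} {x t : ℝ}
    (hg : DifferentiableAt ℝ (fun p : ℝ × ℝ => g p.1 p.2) (x, t)) :
    HasDerivAt (fun s => g x s) (pdt g x t) t :=
  (hasDerivAt_slice_snd hg).differentiableAt.hasDerivAt

theorem pdx_congr {Ω : Set (ℝ × ℝ)} (hΩ : IsOpen Ω) {g h : ℝ → ℝ → ℝ}
    (hgh : ∀ x t : ℝ, (x, t) ∈ Ω → g x t = h x t) {x t : ℝ} (hx : (x, t) ∈ Ω) :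
    pdx g x t = pdx h x t := by
  have hc : ContinuousAt (fun y : ℝ => (y, t)) x := by fun_prop
  refine Filter.EventuallyEq.deriv_eq ?_
  filter_upwards [hc.preimage_mem_nhds (hΩ.mem_nhds hx)] with y hy using hgh y t hy

theorem pdt_congr {Ω : Set (ℝ × ℝ)} (hΩ : IsOpen Ω) {g h : ℝ → ℝ → ℝ}
    (hgh : ∀ x t : ℝ, (x, t) ∈ Ω → g x t = h x t) {x t : ℝ} (hx : (x, t) ∈ Ω) :
    pdt g x t = pdt h x t := by
  have hc : ContinuousAt (fun s : ℝ => (x, s)) t := by fun_prop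
  refine Filter.EventuallyEq.deriv_eq ?_
  filter_upwards [hc.preimage_mem_nhds (hΩ.mem_nhds hx)] with s hs using hgh x s hs

section SecondOrder

variable {Ω : Set (ℝ × ℝ)} {g : ℝ → ℝ → ℝ} {x t : ℝ}

theorem pdx_eq_fderiv (hΩ : IsOpen Ω) (hg : ContDiffOn ℝ 2 (fun p : ℝ × ℝ => g p.1 p.2) Ω)
    (hx : (x, t) ∈ Ω) :
    pdx g x t = fderiv ℝ (fun p : ℝ × ℝ => g p.1 p.2) (x, t) (1, 0) :=
  (hasDerivAt_slice_fst
    ((hg.contDiffAt (hΩ.mem_nhds hx)).differentiableAt (by norm_num))).deriv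

theorem pdt_eq_fderiv (hΩ : IsOpen Ω) (hg : ContDiffOn ℝ 2 (fun p : ℝ × ℝ => g p.1 p.2) Ω)
    (hx : (x, t) ∈ Ω) :
    pdt g x t = fderiv ℝ (fun p : ℝ × ℝ => g p.1 p.2) (x, t) (0, 1) :=
  (hasDerivAt_slice_snd
    ((hg.contDiffAt (hΩ.mem_nhds hx)).differentiableAt (by norm_num))).deriv

theorem differentiableAt_fderiv_of_contDiffOn_two (hΩ : IsOpen Ω)
    (hg : ContDiffOn ℝ 2 (fun p : ℝ × ℝ => g p.1 p.2) Ω) (hx : (x, t) ∈ Ω) :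
    DifferentiableAt ℝ (fderiv ℝ (fun p : ℝ × ℝ => g p.1 p.2)) (x, t) :=
  ((hg.contDiffAt (hΩ.mem_nhds hx)).fderiv_right (m := 1) (by norm_num)).differentiableAt
    (by norm_num)

theorem differentiableAt_pdx (hΩ : IsOpen Ω)
    (hg : ContDiffOn ℝ 2 (fun p : ℝ × ℝ => g p.1 p.2) Ω) (hx : (x, t) ∈ Ω) :
    DifferentiableAt ℝ (fun p : ℝ × ℝ => pdx g p.1 p.2) (x, t) := by
  refine ((differentiableAt_fderiv_of_contDiffOn_two hΩ hg hx).clm_apply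
    (differentiableAt_const ((1 : ℝ), (0 : ℝ)))).congr_of_eventuallyEq ?_
  filter_upwards [hΩ.mem_nhds hx] with p hp using pdx_eq_fderiv hΩ hg hp

theorem differentiableAt_pdt (hΩ : IsOpen Ω)
    (hg : ContDiffOn ℝ 2 (fun p : ℝ × ℝ => g p.1 p.2) Ω) (hx : (x, t) ∈ Ω) :
    DifferentiableAt ℝ (fun p : ℝ × ℝ => pdt g p.1 p.2) (x, t) := by
  refine ((differentiableAt_fderiv_of_contDiffOn_two hΩ hg hx).clm_apply
    (differentiableAt_const ((0 : ℝ), (1 : ℝ)))).congr_of_eventuallyEq ?_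
  filter_upwards [hΩ.mem_nhds hx] with p hp using pdt_eq_fderiv hΩ hg hp

/-- Equality of mixed partial derivatives. -/
theorem pdx_pdt_comm (hΩ : IsOpen Ω) (hg : ContDiffOn ℝ 2 (fun p : ℝ × ℝ => g p.1 p.2) Ω)
    (hx : (x, t) ∈ Ω) : pdx (pdt g) x t = pdt (pdx g) x t := by
  set G : ℝ × ℝ → ℝ := fun p => g p.1 p.2 with hG
  have hd := (differentiableAt_fderiv_of_contDiffOn_two hΩ hg hx).hasFDerivAt
  have h₁ : pdx (pdt g) x t = fderiv ℝ (fderiv ℝ G) (x, t) (1, 0) (0, 1) := by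
    rw [pdx_congr hΩ (h := fun y s => fderiv ℝ G (y, s) (0, 1))
      (fun _ _ h => pdt_eq_fderiv hΩ hg h) hx]
    have := (HasFDerivAt.comp_hasDerivAt (f := fun y => (y, t)) x hd
      ((hasDerivAt_id x).prodMk (hasDerivAt_const x t))).clm_apply
        (hasDerivAt_const x ((0 : ℝ), (1 : ℝ)))
    simpa [pdx, hG] using this.deriv
  have h₂ : pdt (pdx g) x t = fderiv ℝ (fderiv ℝ G) (x, t) (0, 1) (1, 0) := by
    rw [pdt_congr hΩ (h := fun y s => fderiv ℝ G (y, s) (1, 0))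
      (fun _ _ h => pdx_eq_fderiv hΩ hg h) hx]
    have := (HasFDerivAt.comp_hasDerivAt (f := fun s => (x, s)) t hd
      ((hasDerivAt_const t x).prodMk (hasDerivAt_id t))).clm_apply
        (hasDerivAt_const t ((1 : ℝ), (0 : ℝ)))
    simpa [pdt, hG] using this.deriv
  rw [h₁, h₂]
  exact ((hg.contDiffAt (hΩ.mem_nhds hx)).isSymmSndFDerivAt (by simp)).eq _ _

end SecondOrder

/-- If `M` is C² with `M_x = -m` and solves the transport equation `M_t - u_x M_x = 0` for a
classical solution `(u, m)` of the 1D MFG system on the open set `Ω`, then `M` satisfies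
`-(M_t²/M_x²) M_xx + 2 (M_t/M_x) M_xt - M_tt + M_x f'(-M_x) M_xx = 0` on `Ω`. -/
theorem stmt12
    (Ω : Set (ℝ × ℝ)) (hΩ : IsOpen Ω)
    (f : ℝ → ℝ) (hf : ContDiffOn ℝ 1 f (Ioi 0))
    (u m : ℝ → ℝ → ℝ)
    (hu : ContDiffOn ℝ (⊤ : ℕ∞) (fun p : ℝ × ℝ => u p.1 p.2) Ω)
    (hm : ContDiffOn ℝ (⊤ : ℕ∞) (fun p : ℝ × ℝ => m p.1 p.2) Ω)
    (hmpos : ∀ x t : ℝ, (x, t) ∈ Ω → 0 < m x t)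
    (hHJ : ∀ x t : ℝ, (x, t) ∈ Ω →
      -pdt u x t + (1/2) * (pdx u x t)^2 = f (m x t))
    (hCE : ∀ x t : ℝ, (x, t) ∈ Ω →
      pdt m x t - pdx (fun y s => m y s * pdx u y s) x t = 0)
    (M : ℝ → ℝ → ℝ)
    (hM : ContDiffOn ℝ 2 (fun p : ℝ × ℝ => M p.1 p.2) Ω)
    (hMx : ∀ x t : ℝ, (x, t) ∈ Ω → pdx M x t = -m x t)
    (hMt : ∀ x t : ℝ, (x, t) ∈ Ω → pdt M x t - pdx u x t * pdx M x t = 0) :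
    ∀ x t : ℝ, (x, t) ∈ Ω →
      -((pdt M x t)^2 / (pdx M x t)^2) * pdx (pdx M) x t
        + 2 * (pdt M x t / pdx M x t) * pdt (pdx M) x t
        - pdt (pdt M) x t
        + pdx M x t * deriv f (-(pdx M x t)) * pdx (pdx M) x t = 0 := by
  intro x t hx
  have hu₂ : ContDiffOn ℝ 2 (fun p : ℝ × ℝ => u p.1 p.2) Ω :=
    hu.of_le (WithTop.coe_le_coe.mpr (le_top : (2 : ℕ∞) ≤ ⊤))
  have hmd : DifferentiableAt ℝ (fun p : ℝ × ℝ => m p.1 p.2) (x, t) :=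
    (hm.contDiffAt (hΩ.mem_nhds hx)).differentiableAt (by simp)
  have hpos := hmpos x t hx
  have hm_x := hasDerivAt_pdx hmd
  have hm_t := hasDerivAt_pdt hmd
  have hv_x := hasDerivAt_pdx (differentiableAt_pdx hΩ hu₂ hx)
  have hv_t := hasDerivAt_pdt (differentiableAt_pdx hΩ hu₂ hx)
  have hw_x := hasDerivAt_pdx (differentiableAt_pdt hΩ hu₂ hx)
  have hf' : HasDerivAt f (deriv f (m x t)) (m x t) :=
    ((hf.contDiffAt (Ioi_mem_nhds hpos)).differentiableAt (by norm_num)).hasDerivAt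
  have hMxx : pdx (pdx M) x t = -pdx m x t :=
    (pdx_congr hΩ (h := fun y s => -m y s) hMx hx).trans hm_x.neg.deriv
  have hMxt : pdt (pdx M) x t = -pdt m x t :=
    (pdt_congr hΩ (h := fun y s => -m y s) hMx hx).trans hm_t.neg.deriv
  have hMt_eq : ∀ y s : ℝ, (y, s) ∈ Ω → pdt M y s = -(m y s * pdx u y s) := by
    intro y s hy
    have h := hMt y s hy
    rw [hMx y s hy] at h
    linarith
  have hMtt : pdt (pdt M) x t = -(pdt m x t * pdx u x t + m x t * pdt (pdx u) x t) :=
    (pdt_congr hΩ (h := fun y s => -(m y s * pdx u y s)) hMt_eq hx).trans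
      (hm_t.mul hv_t).neg.deriv
  have hflux : pdt m x t = pdx m x t * pdx u x t + m x t * pdx (pdx u) x t :=
    (sub_eq_zero.mp (hCE x t hx)).trans (hm_x.mul hv_x).deriv
  have hHJ_x : -pdx (pdt u) x t + pdx u x t * pdx (pdx u) x t
      = deriv f (m x t) * pdx m x t := by
    have hl := (hw_x.neg.add ((hv_x.pow 2).const_mul (1 / 2 : ℝ))).deriv
    have hr := (hf'.comp x hm_x).deriv
    have he := pdx_congr hΩ (g := fun y s => -pdt u y s + (1/2) * (pdx u y s)^2)
      (h := fun y s => f (m y s)) hHJ hx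
    have h := hl.symm.trans (he.trans hr)
    norm_num at h
    linarith
  rw [pdx_pdt_comm hΩ hu₂ hx] at hHJ_x
  have hv : pdt M x t / pdx M x t = pdx u x t := by
    rw [hMt_eq x t hx, hMx x t hx]
    field_simp
  rw [← div_pow, hv, hMxx, hMxt, hMtt, hMx x t hx, neg_neg]
  linear_combination (-pdx u x t) * hflux - m x t * hHJ_x
end
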